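/- (Extrapolation of the Khintchine inequality below exponent 1.) Let 1<q<2 and 0<p<1. Suppose there is a constant β such that for all n, N and all x_1,…,x_N ∈ M_n(ℂ) one has |||x|||_q ≤ β (E_ε ‖∑_k ε_k x_k‖_q^q)^{1/q}. Then there is a constant β′, depending only on p, q and β, such that for all n, N and all x_1,…,x_N ∈ M_n(ℂ) one has |||x|||_p ≤ β′ (E_ε ‖∑_k ε_k x_k‖_p^p)^{1/p}. -/

import Mathlib

open scoped BigOperators
open Matrix MeasureTheory
open scoped ComplexOrder

/-- `A^β` for a Hermitian (in practice positive semidefinite) matrix `A`, via the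
spectral functional calculus (with the conventions of `Real.rpow` on eigenvalues,
in particular `0 ^ β = 0` for `β ≠ 0`), extended by `0` to non-Hermitian matrices. -/
noncomputable def posPow {ι : Type*} [Fintype ι] [DecidableEq ι]
    (A : Matrix ι ι ℂ) (β : ℝ) : Matrix ι ι ℂ :=
  if hA : A.IsHermitian then hA.cfc (fun t => t ^ β) else 0

/-- Schatten `p`-(quasi)norm of a complex matrix: `(Tr((A*A)^(p/2)))^(1/p)`. -/
noncomputable def schattenNorm {ι : Type*} [Fintype ι] [DecidableEq ι]
    (p : ℝ) (A : Matrix ι ι ℂ) : ℝ :=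
  ((posPow (Aᴴ * A) (p / 2)).trace.re) ^ (1 / p)

/-- Operator norm of a matrix, acting on the Euclidean space. -/
noncomputable def opNorm {ι : Type*} [Fintype ι] [DecidableEq ι]
    (A : Matrix ι ι ℂ) : ℝ :=
  ‖Matrix.toEuclideanCLM (𝕜 := ℂ) A‖

/-- The quantity `|||x|||_p` for `0 < p ≤ 2`: the infimum of
`‖(∑ aₖ*aₖ)^(1/2)‖_p + ‖(∑ bₖbₖ*)^(1/2)‖_p` over decompositions `xₖ = aₖ + bₖ`. -/
noncomputable def tripleNorm {n N : ℕ} (p : ℝ)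
    (x : Fin N → Matrix (Fin n) (Fin n) ℂ) : ℝ :=
  sInf { r : ℝ | ∃ a b : Fin N → Matrix (Fin n) (Fin n) ℂ,
    (∀ k, x k = a k + b k) ∧
    r = schattenNorm p (posPow (∑ k, (a k)ᴴ * a k) (1/2))
        + schattenNorm p (posPow (∑ k, b k * (b k)ᴴ) (1/2)) }

/-- `E_ε ‖∑ ε_k x_k‖_p ^ p`, the average over a uniformly random choice of signs. -/
noncomputable def radAvg {n N : ℕ} (p : ℝ)
    (x : Fin N → Matrix (Fin n) (Fin n) ℂ) : ℝ :=
  (1 / 2 ^ N) * ∑ ε : Fin N → Bool,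
    (schattenNorm p (∑ k, (if ε k then (1 : ℂ) else -1) • x k)) ^ p

/-- The sum of `ψ` over the eigenvalues of `A`, counted with multiplicity. -/
noncomputable def specSum {ι : Type*} [Fintype ι] [DecidableEq ι]
    (ψ : ℝ → ℝ) (A : Matrix ι ι ℂ) : ℝ :=
  (A.charpoly.roots.map fun z => ψ z.re).sum

lemma diag_re_nonneg {ι : Type*} {A : Matrix ι ι ℂ} (hA : A.PosSemidef) (i : ι) :
    0 ≤ (A i i).re :=
  (Complex.le_def.1 (hA.diag_nonneg (i := i))).1

section SpecSum

variable {ι : Type*} [Fintype ι] [DecidableEq ι]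

lemma specSum_eq_sum_eigenvalues (ψ : ℝ → ℝ) {A : Matrix ι ι ℂ} (hA : A.IsHermitian) :
    specSum ψ A = ∑ i, ψ (hA.eigenvalues i) := by
  simp [specSum, hA.roots_charpoly_eq_eigenvalues]

lemma specSum_mul_comm (ψ : ℝ → ℝ) (A B : Matrix ι ι ℂ) :
    specSum ψ (A * B) = specSum ψ (B * A) := by
  rw [specSum, specSum, Matrix.charpoly_mul_comm]

lemma specSum_conj (ψ : ℝ → ℝ) (A : Matrix ι ι ℂ) {V : Matrix ι ι ℂ} (hV : V * Vᴴ = 1) :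
    specSum ψ (Vᴴ * A * V) = specSum ψ A := by
  rw [specSum_mul_comm, ← Matrix.mul_assoc, hV, Matrix.one_mul]

lemma specSum_fromBlocks (ψ : ℝ → ℝ) (A B : Matrix ι ι ℂ) :
    specSum ψ (Matrix.fromBlocks A 0 0 B) = specSum ψ A + specSum ψ B := by
  rw [specSum, Matrix.charpoly_fromBlocks_zero₁₂, Polynomial.roots_mul, Multiset.map_add,
    Multiset.sum_add, specSum, specSum]
  exact mul_ne_zero (Matrix.charpoly_monic A).ne_zero (Matrix.charpoly_monic B).ne_zero

lemma specSum_diagonal (ψ : ℝ → ℝ) (ν : ι → ℝ) :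
    specSum ψ (Matrix.diagonal fun i => (ν i : ℂ)) = ∑ i, ψ (ν i) := by
  rw [specSum, Matrix.charpoly_diagonal, Finset.prod_eq_multiset_prod]
  have := Polynomial.roots_multiset_prod_X_sub_C
    ((Finset.univ : Finset ι).val.map fun i => (ν i : ℂ))
  rw [Multiset.map_map] at this
  simp only [Function.comp_def] at this
  rw [this]
  simp

lemma specSum_zero {ψ : ℝ → ℝ} (h0 : ψ 0 = 0) : specSum ψ (0 : Matrix ι ι ℂ) = 0 := by
  simpa [h0] using specSum_diagonal ψ (0 : ι → ℝ)

lemma exists_unitary_diagonal {A : Matrix ι ι ℂ} (hA : A.PosSemidef) :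
    ∃ (V : Matrix ι ι ℂ) (ν : ι → ℝ), Vᴴ * V = 1 ∧ V * Vᴴ = 1 ∧ (∀ i, 0 ≤ ν i) ∧
      Vᴴ * A * V = Matrix.diagonal (fun i => (ν i : ℂ)) ∧
      ∀ ψ : ℝ → ℝ, specSum ψ A = ∑ i, ψ (ν i) := by
  have h1 : (hA.1.eigenvectorUnitary : Matrix ι ι ℂ)ᴴ * hA.1.eigenvectorUnitary = 1 :=
    Unitary.coe_star_mul_self hA.1.eigenvectorUnitary
  have h2 : (hA.1.eigenvectorUnitary : Matrix ι ι ℂ) *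
      (hA.1.eigenvectorUnitary : Matrix ι ι ℂ)ᴴ = 1 :=
    Unitary.coe_mul_star_self hA.1.eigenvectorUnitary
  refine ⟨hA.1.eigenvectorUnitary, hA.1.eigenvalues, h1, h2, hA.eigenvalues_nonneg, ?_,
    fun ψ => specSum_eq_sum_eigenvalues ψ hA.1⟩
  have h := hA.1.spectral_theorem
  rw [Unitary.conjStarAlgAut_apply] at h
  set D : Matrix ι ι ℂ := Matrix.diagonal (RCLike.ofReal ∘ hA.1.eigenvalues) with hD
  have h' : A = (hA.1.eigenvectorUnitary : Matrix ι ι ℂ) * D *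
      (hA.1.eigenvectorUnitary : Matrix ι ι ℂ)ᴴ := h
  have : (hA.1.eigenvectorUnitary : Matrix ι ι ℂ)ᴴ * A * hA.1.eigenvectorUnitary = D := by
    generalize (hA.1.eigenvectorUnitary : Matrix ι ι ℂ) = U at h' h1 h2
    rw [h']
    calc Uᴴ * (U * D * Uᴴ) * U = (Uᴴ * U) * D * (Uᴴ * U) := by simp only [Matrix.mul_assoc]
      _ = D := by rw [h1]; simp
  rw [this]
  rfl

lemma sum_normSq_row {V : Matrix ι ι ℂ} (hV : V * Vᴴ = 1) (i : ι) :
    ∑ j, Complex.normSq (V i j) = 1 := by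
  have h := congrFun (congrFun hV i) i
  rw [Matrix.mul_apply, Matrix.one_apply_eq] at h
  have : ((∑ j, Complex.normSq (V i j) : ℝ) : ℂ) = 1 := by
    rw [← h]; push_cast
    exact Finset.sum_congr rfl fun j _ => by
      rw [Matrix.conjTranspose_apply, Complex.star_def, Complex.mul_conj]
  exact_mod_cast this

lemma sum_normSq_col {V : Matrix ι ι ℂ} (hV : Vᴴ * V = 1) (j : ι) :
    ∑ i, Complex.normSq (V i j) = 1 := by
  have h := sum_normSq_row (V := Vᴴ) (by rwa [Matrix.conjTranspose_conjTranspose]) j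
  simpa [Matrix.conjTranspose_apply, Complex.normSq_conj] using h

lemma diag_re_eq_sum {A V : Matrix ι ι ℂ} {ν : ι → ℝ} (hV : V * Vᴴ = 1)
    (h : Vᴴ * A * V = Matrix.diagonal (fun i => (ν i : ℂ))) (i : ι) :
    (A i i).re = ∑ j, Complex.normSq (V i j) * ν j := by
  have hA : A = V * Matrix.diagonal (fun i => (ν i : ℂ)) * Vᴴ := by
    rw [← h]
    calc A = (V * Vᴴ) * A * (V * Vᴴ) := by rw [hV]; simp
      _ = _ := by simp only [Matrix.mul_assoc]
  rw [hA, Matrix.mul_apply, Complex.re_sum]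
  refine Finset.sum_congr rfl fun j _ => ?_
  rw [Matrix.mul_diagonal, Matrix.conjTranspose_apply, Complex.star_def, mul_right_comm,
    Complex.mul_conj, ← Complex.ofReal_mul, Complex.ofReal_re]

/-- The Peierls inequality for a concave function. -/
lemma specSum_le_sum_diag {A : Matrix ι ι ℂ} (hA : A.PosSemidef) {ψ : ℝ → ℝ}
    (hψ : ConcaveOn ℝ (Set.Ici 0) ψ) : specSum ψ A ≤ ∑ i, ψ (A i i).re := by
  obtain ⟨V, ν, hV1, hV2, hν, hd, hs⟩ := exists_unitary_diagonal hA
  rw [hs]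
  calc ∑ j, ψ (ν j) = ∑ j, (∑ i, Complex.normSq (V i j)) * ψ (ν j) := by
        simp [sum_normSq_col hV1]
    _ = ∑ i, ∑ j, Complex.normSq (V i j) * ψ (ν j) := by
        simp_rw [Finset.sum_mul]; exact Finset.sum_comm
    _ ≤ _ := by
        refine Finset.sum_le_sum fun i _ => ?_
        rw [diag_re_eq_sum hV2 hd i]
        have := hψ.le_map_sum (t := Finset.univ) (w := fun j => Complex.normSq (V i j)) (p := ν)
          (fun j _ => Complex.normSq_nonneg _) (sum_normSq_row hV2 i) (fun j _ => hν j)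
        simpa [smul_eq_mul] using this

lemma specSum_le_sum_diag_conj {A V : Matrix ι ι ℂ} (hA : A.PosSemidef) (hV : V * Vᴴ = 1)
    {ψ : ℝ → ℝ} (hψ : ConcaveOn ℝ (Set.Ici 0) ψ) :
    specSum ψ A ≤ ∑ i, ψ ((Vᴴ * A * V) i i).re := by
  rw [← specSum_conj ψ A hV]
  exact specSum_le_sum_diag (hA.conjTranspose_mul_mul_same V) hψ

lemma specSum_mono {A B : Matrix ι ι ℂ} (hA : A.PosSemidef) (hAB : (B - A).PosSemidef)
    {ψ : ℝ → ℝ} (hψ : ConcaveOn ℝ (Set.Ici 0) ψ) (hm : MonotoneOn ψ (Set.Ici 0)) :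
    specSum ψ A ≤ specSum ψ B := by
  have hB : B.PosSemidef := by simpa using hAB.add hA
  obtain ⟨V, ν, hV1, hV2, hν, hd, hs⟩ := exists_unitary_diagonal hB
  rw [hs]
  refine (specSum_le_sum_diag_conj hA hV2 hψ).trans (Finset.sum_le_sum fun i _ => ?_)
  have h1 := diag_re_nonneg (hA.conjTranspose_mul_mul_same V) i
  have h2 := diag_re_nonneg (hAB.conjTranspose_mul_mul_same V) i
  rw [Matrix.mul_sub, Matrix.sub_mul, hd] at h2
  simp only [Matrix.sub_apply, Matrix.diagonal_apply_eq, Complex.sub_re, Complex.ofReal_re] at h2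
  exact hm h1 (hν i) (by linarith)

lemma exists_gram {A : Matrix ι ι ℂ} (hA : A.PosSemidef) : ∃ X : Matrix ι ι ℂ, A = Xᴴ * X := by
  obtain ⟨V, ν, hV1, hV2, hν, hd, -⟩ := exists_unitary_diagonal hA
  refine ⟨Matrix.diagonal (fun i => ((√(ν i) : ℝ) : ℂ)) * Vᴴ, ?_⟩
  rw [Matrix.conjTranspose_mul, Matrix.conjTranspose_conjTranspose, Matrix.diagonal_conjTranspose]
  calc A = (V * Vᴴ) * A * (V * Vᴴ) := by rw [hV2]; simp
    _ = V * (Vᴴ * A * V) * Vᴴ := by simp only [Matrix.mul_assoc]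
    _ = _ := by
      rw [hd, Matrix.mul_assoc V, Matrix.mul_assoc V, ← Matrix.mul_assoc (Matrix.diagonal _),
        Matrix.diagonal_mul_diagonal]
      congr 3
      ext i
      simp [← Complex.ofReal_mul, Real.mul_self_sqrt (hν i)]

/-- The Rotfeld inequality. -/
lemma specSum_add_le {A B : Matrix ι ι ℂ} (hA : A.PosSemidef) (hB : B.PosSemidef)
    {ψ : ℝ → ℝ} (hψ : ConcaveOn ℝ (Set.Ici 0) ψ) (h0 : ψ 0 = 0) :
    specSum ψ (A + B) ≤ specSum ψ A + specSum ψ B := by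
  obtain ⟨X, rfl⟩ := exists_gram hA
  obtain ⟨Y, rfl⟩ := exists_gram hB
  set W : Matrix (ι ⊕ ι) (ι ⊕ ι) ℂ := Matrix.fromBlocks X 0 Y 0 with hW
  have hW1 : Wᴴ * W = Matrix.fromBlocks (Xᴴ * X + Yᴴ * Y) 0 0 0 := by
    simp [hW, Matrix.fromBlocks_conjTranspose, Matrix.fromBlocks_multiply]
  have hW2 : W * Wᴴ = Matrix.fromBlocks (X * Xᴴ) (X * Yᴴ) (Y * Xᴴ) (Y * Yᴴ) := by
    simp [hW, Matrix.fromBlocks_conjTranspose, Matrix.fromBlocks_multiply]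
  obtain ⟨U, ν, hU1, hU2, hν, hd, hs⟩ :=
    exists_unitary_diagonal (Matrix.posSemidef_self_mul_conjTranspose X)
  obtain ⟨V, ξ, hV1, hV2, hξ, he, ht⟩ :=
    exists_unitary_diagonal (Matrix.posSemidef_self_mul_conjTranspose Y)
  calc specSum ψ (Xᴴ * X + Yᴴ * Y) = specSum ψ (Wᴴ * W) := by
        rw [hW1, specSum_fromBlocks, specSum_zero h0, add_zero]
    _ = specSum ψ (W * Wᴴ) := specSum_mul_comm _ _ _
    _ ≤ _ := specSum_le_sum_diag_conj (Matrix.posSemidef_self_mul_conjTranspose W)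
        (V := Matrix.fromBlocks U 0 0 V) (by
          simp [Matrix.fromBlocks_conjTranspose, Matrix.fromBlocks_multiply, hU2, hV2]) hψ
    _ = specSum ψ (Xᴴ * X) + specSum ψ (Yᴴ * Y) := by
        rw [specSum_mul_comm ψ Xᴴ X, specSum_mul_comm ψ Yᴴ Y, hs, ht, Fintype.sum_sum_type, hW2]
        simp [Matrix.fromBlocks_conjTranspose, Matrix.fromBlocks_multiply, hd, he]

lemma specSum_sum_le {κ : Type*} (s : Finset κ) {A : κ → Matrix ι ι ℂ}
    (hA : ∀ k, (A k).PosSemidef)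
    {ψ : ℝ → ℝ} (hψ : ConcaveOn ℝ (Set.Ici 0) ψ) (h0 : ψ 0 = 0) :
    specSum ψ (∑ k ∈ s, A k) ≤ ∑ k ∈ s, specSum ψ (A k) := by
  classical
  induction s using Finset.induction_on with
  | empty => simp [specSum_zero h0]
  | insert a s ha ih =>
    rw [Finset.sum_insert ha, Finset.sum_insert ha]
    exact (specSum_add_le (hA a) (Matrix.posSemidef_sum s fun k _ => hA k) hψ h0).trans
      (by linarith)

lemma specSum_le_specSum {A : Matrix ι ι ℂ} (hA : A.PosSemidef) {φ ψ : ℝ → ℝ}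
    (h : ∀ t, 0 ≤ t → φ t ≤ ψ t) : specSum φ A ≤ specSum ψ A := by
  rw [specSum_eq_sum_eigenvalues _ hA.1, specSum_eq_sum_eigenvalues _ hA.1]
  exact Finset.sum_le_sum fun i _ => h _ (hA.eigenvalues_nonneg i)

lemma specSum_nonneg {A : Matrix ι ι ℂ} (hA : A.PosSemidef) {ψ : ℝ → ℝ}
    (h : ∀ t, 0 ≤ t → 0 ≤ ψ t) : 0 ≤ specSum ψ A := by
  rw [specSum_eq_sum_eigenvalues _ hA.1]
  exact Finset.sum_nonneg fun i _ => h _ (hA.eigenvalues_nonneg i)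

lemma specSum_smul {A : Matrix ι ι ℂ} (hA : A.PosSemidef) (c : ℝ) (ψ : ℝ → ℝ) :
    specSum ψ ((c : ℂ) • A) = specSum (fun t => ψ (c * t)) A := by
  obtain ⟨V, ν, hV1, hV2, hν, hd, hs⟩ := exists_unitary_diagonal hA
  rw [hs, ← specSum_conj ψ _ hV2, Matrix.mul_smul, Matrix.smul_mul, hd, ← Matrix.diagonal_smul,
    show (c : ℂ) • (fun i => (ν i : ℂ)) = fun i => ((c * ν i : ℝ) : ℂ) by ext i; simp,
    specSum_diagonal]

end SpecSum

lemma concaveOn_rpow_Ici {s : ℝ} (hs0 : 0 ≤ s) (hs1 : s ≤ 1) :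
    ConcaveOn ℝ (Set.Ici 0) fun t : ℝ => t ^ s :=
  Real.concaveOn_rpow hs0 hs1

lemma sum_rpow_mul_rpow_le {κ : Type*} (S : Finset κ) (u v : κ → ℝ) {s : ℝ} (hs0 : 0 < s)
    (hs1 : s < 1) (hu : ∀ i, 0 ≤ u i) (hv : ∀ i, 0 ≤ v i) :
    ∑ i ∈ S, u i ^ s * v i ^ (1 - s) ≤ (∑ i ∈ S, u i) ^ s * (∑ i ∈ S, v i) ^ (1 - s) := by
  have hs : 0 < 1 - s := by linarith
  have hpq : Real.HolderConjugate (1 / s) (1 / (1 - s)) := by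
    rw [Real.holderConjugate_iff]
    constructor
    · rw [lt_div_iff₀ hs0]; linarith
    · simp
  have h := Real.inner_le_Lp_mul_Lq_of_nonneg S hpq
    (fun i _ => Real.rpow_nonneg (hu i) s) (fun i _ => Real.rpow_nonneg (hv i) (1 - s))
  simp only [one_div_one_div] at h
  convert h using 4 with i _ i _
  · rw [← Real.rpow_mul (hu i), mul_one_div_cancel hs0.ne', Real.rpow_one]
  · rw [← Real.rpow_mul (hv i), mul_one_div_cancel hs.ne', Real.rpow_one]

lemma posSemidef_sum_gram {ι κ : Type*} [Fintype ι] [Fintype κ] (a : κ → Matrix ι ι ℂ) :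
    (∑ k, (a k)ᴴ * a k).PosSemidef :=
  Matrix.posSemidef_sum _ fun k _ => Matrix.posSemidef_conjTranspose_mul_self (a k)

section Schatten

variable {ι κ : Type*} [Fintype ι] [DecidableEq ι] [Fintype κ]

lemma schattenNorm_eq (p : ℝ) (A : Matrix ι ι ℂ) :
    schattenNorm p A = (specSum (fun t => t ^ (p / 2)) (Aᴴ * A)) ^ (1 / p) := by
  have hA : (Aᴴ * A).IsHermitian := (Matrix.posSemidef_conjTranspose_mul_self A).1
  rw [schattenNorm, posPow, dif_pos hA, specSum_eq_sum_eigenvalues _ hA, Matrix.IsHermitian.cfc,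
    Unitary.conjStarAlgAut_apply, Matrix.trace_mul_comm, ← Matrix.mul_assoc,
    Unitary.coe_star_mul_self, Matrix.one_mul, Matrix.trace_diagonal, Complex.re_sum]
  simp

lemma posPow_half_gram {A : Matrix ι ι ℂ} (hA : A.PosSemidef) :
    (posPow A (1 / 2))ᴴ * posPow A (1 / 2) = A := by
  have h1 : star (hA.1.eigenvectorUnitary : Matrix ι ι ℂ) * hA.1.eigenvectorUnitary = 1 :=
    Unitary.coe_star_mul_self hA.1.eigenvectorUnitary
  conv_rhs => rw [hA.1.spectral_theorem]
  rw [posPow, dif_pos hA.1, Matrix.IsHermitian.cfc, Unitary.conjStarAlgAut_apply,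
    Unitary.conjStarAlgAut_apply, ← Matrix.star_eq_conjTranspose, star_mul, star_mul, star_star]
  generalize (hA.1.eigenvectorUnitary : Matrix ι ι ℂ) = U at h1
  set D : Matrix ι ι ℂ :=
    Matrix.diagonal (RCLike.ofReal ∘ (fun t : ℝ => t ^ (1 / 2 : ℝ)) ∘ hA.1.eigenvalues) with hD
  have hDD : star D * D = Matrix.diagonal (RCLike.ofReal ∘ hA.1.eigenvalues) := by
    rw [hD, Matrix.star_eq_conjTranspose, Matrix.diagonal_conjTranspose,
      Matrix.diagonal_mul_diagonal]
    congr 1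
    ext i
    simp only [Function.comp_apply, Pi.star_apply, RCLike.star_def, RCLike.conj_ofReal]
    rw [← RCLike.ofReal_mul, ← Real.rpow_add_of_nonneg (hA.eigenvalues_nonneg i) (by norm_num)
      (by norm_num)]
    norm_num
  calc U * (star D * star U) * (U * D * star U) = U * (star D * (star U * U) * D) * star U := by
        simp only [mul_assoc]
    _ = _ := by rw [h1, mul_one, hDD]

lemma schattenNorm_posPow_half (p : ℝ) {A : Matrix ι ι ℂ} (hA : A.PosSemidef) :
    schattenNorm p (posPow A (1 / 2)) = (specSum (fun t => t ^ (p / 2)) A) ^ (1 / p) := by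
  rw [schattenNorm_eq, posPow_half_gram hA]

lemma specSum_rpow_nonneg {A : Matrix ι ι ℂ} (hA : A.PosSemidef) (s : ℝ) :
    0 ≤ specSum (fun t => t ^ s) A :=
  specSum_nonneg hA fun _ ht => Real.rpow_nonneg ht s

lemma schattenNorm_rpow {p : ℝ} (hp : 0 < p) (A : Matrix ι ι ℂ) :
    schattenNorm p A ^ p = specSum (fun t => t ^ (p / 2)) (Aᴴ * A) := by
  rw [schattenNorm_eq, ← Real.rpow_mul
    (specSum_rpow_nonneg (Matrix.posSemidef_conjTranspose_mul_self A) _),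
    one_div_mul_cancel hp.ne', Real.rpow_one]

/-- Quasi-triangle inequality for column square functions. -/
lemma specSum_gram_add_le (a b : κ → Matrix ι ι ℂ) {s : ℝ} (hs0 : 0 < s) (hs1 : s ≤ 1) :
    specSum (fun t => t ^ s) (∑ k, (a k + b k)ᴴ * (a k + b k)) ≤
      2 * (specSum (fun t => t ^ s) (∑ k, (a k)ᴴ * a k) +
        specSum (fun t => t ^ s) (∑ k, (b k)ᴴ * b k)) := by
  have hc := concaveOn_rpow_Ici hs0.le hs1
  have hA := posSemidef_sum_gram a
  have hB := posSemidef_sum_gram b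
  have hAB := hA.add hB
  set A := ∑ k, (a k)ᴴ * a k
  set B := ∑ k, (b k)ᴴ * b k
  have h1 : specSum (fun t => t ^ s) (∑ k, (a k + b k)ᴴ * (a k + b k)) ≤
      specSum (fun t => t ^ s) (((2 : ℝ) : ℂ) • (A + B)) := by
    refine specSum_mono (posSemidef_sum_gram _) ?_ hc
      (Real.monotoneOn_rpow_Ici_of_exponent_nonneg hs0.le)
    have : ((2 : ℝ) : ℂ) • (A + B) - ∑ k, (a k + b k)ᴴ * (a k + b k) =
        ∑ k, (a k - b k)ᴴ * (a k - b k) := by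
      simp only [A, B, ← Finset.sum_add_distrib, Finset.smul_sum, ← Finset.sum_sub_distrib]
      refine Finset.sum_congr rfl fun k _ => ?_
      simp only [Matrix.conjTranspose_add, Matrix.conjTranspose_sub, Matrix.add_mul,
        Matrix.mul_add, Matrix.sub_mul, Matrix.mul_sub, Complex.ofReal_ofNat, two_smul]
      abel
    rw [this]
    exact posSemidef_sum_gram _
  refine h1.trans ?_
  rw [specSum_smul hAB]
  have h2 : specSum (fun t => (2 * t) ^ s) (A + B) ≤ 2 * specSum (fun t => t ^ s) (A + B) := by
    rw [specSum_eq_sum_eigenvalues _ hAB.1, specSum_eq_sum_eigenvalues _ hAB.1, Finset.mul_sum]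
    refine Finset.sum_le_sum fun i _ => ?_
    rw [Real.mul_rpow (by norm_num) (hAB.eigenvalues_nonneg i)]
    refine mul_le_mul_of_nonneg_right ?_ (Real.rpow_nonneg (hAB.eigenvalues_nonneg i) s)
    calc (2 : ℝ) ^ s ≤ 2 ^ (1 : ℝ) := Real.rpow_le_rpow_of_exponent_le (by norm_num) hs1
      _ = 2 := Real.rpow_one 2
  have h3 := specSum_add_le hA hB hc (by simp [hs0.ne'])
  linarith

end Schatten

lemma min_rpow_le_telescope {r : ℝ} (hr : 1 < r) :
    ∃ (C : ℝ) (H : ℝ → ℝ), 0 < C ∧ (∀ y, 0 < y → 0 ≤ H y ∧ H y ≤ 1) ∧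
      ∀ y, 0 < y → min (y ^ (r - 1)) y⁻¹ ≤ C * (H (2 * y) - H y) := by
  set e := min (r - 1) 1 with he
  have he0 : 0 < e := lt_min (by linarith) one_pos
  set a := (2 : ℝ) ^ e with ha
  have ha1 : 1 < a := Real.one_lt_rpow (by norm_num) he0
  have hane : a - 1 ≠ 0 := by linarith
  refine ⟨4 * a / (a - 1), fun y => y ^ e / (1 + y ^ e),
    div_pos (by linarith) (by linarith), fun y hy => ?_, fun y hy => ?_⟩
  · have := Real.rpow_pos_of_pos hy e
    exact ⟨by positivity, by rw [div_le_one (by positivity)]; linarith⟩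
  · have hs : 0 < y ^ e := Real.rpow_pos_of_pos hy e
    have h1 : min (y ^ (r - 1)) y⁻¹ ≤ 4 * y ^ e / (1 + y ^ e) ^ 2 := by
      rw [le_div_iff₀ (by positivity)]
      rcases le_total y 1 with h | h
      · have hs1 : y ^ e ≤ 1 := Real.rpow_le_one hy.le h he0.le
        have h2 : min (y ^ (r - 1)) y⁻¹ ≤ y ^ e := (min_le_left _ _).trans
          (Real.rpow_le_rpow_of_exponent_ge hy h (min_le_left _ _))
        calc _ ≤ y ^ e * (1 + y ^ e) ^ 2 := by gcongr
          _ ≤ y ^ e * 2 ^ 2 := by gcongr; linarith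
          _ = _ := by ring
      · have hs1 : 1 ≤ y ^ e := Real.one_le_rpow h he0.le
        have h2 : min (y ^ (r - 1)) y⁻¹ ≤ (y ^ e)⁻¹ := (min_le_right _ _).trans
          (inv_anti₀ hs (by
            calc y ^ e ≤ y ^ (1 : ℝ) := Real.rpow_le_rpow_of_exponent_le h (min_le_right _ _)
              _ = y := Real.rpow_one y))
        calc _ ≤ (y ^ e)⁻¹ * (1 + y ^ e) ^ 2 := by gcongr
          _ ≤ (y ^ e)⁻¹ * (2 * y ^ e) ^ 2 := by gcongr; linarith
          _ = _ := by field_simp; ring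
    refine h1.trans ?_
    beta_reduce
    rw [Real.mul_rpow (by norm_num) hy.le, ← ha]
    have h3 : a * y ^ e / (1 + a * y ^ e) - y ^ e / (1 + y ^ e) =
        y ^ e * (a - 1) / ((1 + a * y ^ e) * (1 + y ^ e)) := by
      field_simp; ring
    rw [h3]
    have h4 : 4 * a / (a - 1) * (y ^ e * (a - 1) / ((1 + a * y ^ e) * (1 + y ^ e))) =
        4 * y ^ e / ((1 + a * y ^ e) / a * (1 + y ^ e)) := by
      field_simp
    rw [h4]
    gcongr 4 * y ^ e / ?_
    rw [sq]
    gcongr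
    rw [div_le_iff₀ (by linarith)]
    nlinarith

lemma sum_min_rpow_le {p q : ℝ} (hp : 0 < p) (hpq : p < q) :
    ∃ C : ℝ, 0 < C ∧ ∀ (K : ℕ) (c t : ℝ), 0 < c → 0 ≤ t →
      ∑ m ∈ Finset.range K,
        min ((((((1 / 2 : ℝ) ^ m) ^ (-(1 / p - 1 / q))) ^ 2) * t) ^ (q / 2))
          (c ^ q * (1 / 2 : ℝ) ^ m) ≤ C * c ^ (q - p) * t ^ (p / 2) := by
  have hq : 0 < q := hp.trans hpq
  obtain ⟨C, H, hC, hH, hF⟩ := min_rpow_le_telescope (r := q / p) (by rwa [one_lt_div hp])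
  refine ⟨C, hC, fun K c t hc ht => ?_⟩
  rcases ht.eq_or_lt with rfl | ht
  · refine (Finset.sum_nonpos fun m _ => (min_le_left _ _).trans ?_).trans (by positivity)
    rw [mul_zero, Real.zero_rpow (by positivity)]
  set w := t ^ (p / 2) / c ^ p with hw
  have hw0 : 0 < w := by positivity
  have hwr : w ^ (q / p) * c ^ q = t ^ (q / 2) := by
    rw [hw, Real.div_rpow (by positivity) (by positivity), ← Real.rpow_mul ht.le,
      ← Real.rpow_mul hc.le]
    have e1 : p / 2 * (q / p) = q / 2 := by field_simp
    have e2 : p * (q / p) = q := by field_simp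
    rw [e1, e2]
    field_simp
  have key : ∀ m : ℕ, min ((((((1 / 2 : ℝ) ^ m) ^ (-(1 / p - 1 / q))) ^ 2) * t) ^ (q / 2))
          (c ^ q * (1 / 2 : ℝ) ^ m) ≤
        c ^ q * w * (C * (H (2 ^ (m + 1) * w) - H (2 ^ m * w))) := by
    intro m
    set ω := (1 / 2 : ℝ) ^ m with hω
    have hω0 : 0 < ω := by positivity
    have hy : (2 : ℝ) ^ m * w = w / ω := by
      rw [hω, one_div, inv_pow]; field_simp
    have h := hF (w / ω) (by positivity)
    rw [← hy, ← mul_assoc, ← pow_succ'] at h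
    refine le_trans (le_of_eq ?_) (mul_le_mul_of_nonneg_left h (by positivity))
    rw [mul_min_of_nonneg _ _ (by positivity), hy]
    congr 1
    · rw [Real.mul_rpow (by positivity) ht.le, ← hwr, ← Real.rpow_natCast (ω ^ _) 2,
        ← Real.rpow_mul hω0.le, ← Real.rpow_mul hω0.le, Real.div_rpow hw0.le hω0.le,
        Real.rpow_sub_one hw0.ne']
      have e : -(1 / p - 1 / q) * ((2 : ℕ) : ℝ) * (q / 2) = -(q / p - 1) := by
        push_cast; field_simp
      rw [e, Real.rpow_neg hω0.le]
      field_simp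
    · field_simp
  refine (Finset.sum_le_sum fun m _ => key m).trans ?_
  rw [← Finset.mul_sum, ← Finset.mul_sum, Finset.sum_range_sub (fun m => H (2 ^ m * w))]
  have h1 := (hH (2 ^ K * w) (by positivity)).2
  have h2 := (hH (2 ^ 0 * w) (by positivity)).1
  calc c ^ q * w * (C * (H (2 ^ K * w) - H (2 ^ 0 * w))) ≤ c ^ q * w * (C * 1) := by
        gcongr; linarith
    _ = _ := by rw [hw, Real.rpow_sub hc]; field_simp

lemma trace_gram_re {ι : Type*} [Fintype ι] (X : Matrix ι ι ℂ) :
    (Xᴴ * X).trace.re = ∑ a, ∑ b, Complex.normSq (X a b) := by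
  rw [Matrix.trace, Complex.re_sum, Finset.sum_comm]
  refine Finset.sum_congr rfl fun b _ => ?_
  rw [Matrix.diag_apply, Matrix.mul_apply, Complex.re_sum]
  refine Finset.sum_congr rfl fun a _ => ?_
  rw [Matrix.conjTranspose_apply, Complex.star_def, mul_comm, Complex.mul_conj, Complex.ofReal_re]

section Blocks

variable {ι : Type*} [Fintype ι] [DecidableEq ι]

lemma specSum_add_mul {A : Matrix ι ι ℂ} (hA : A.PosSemidef) (φ : ℝ → ℝ) (c : ℝ) :
    specSum (fun t => φ t + c * t) A = specSum φ A + c * A.trace.re := by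
  rw [specSum_eq_sum_eigenvalues _ hA.1, specSum_eq_sum_eigenvalues _ hA.1,
    hA.1.trace_eq_sum_eigenvalues, Finset.sum_add_distrib, Complex.re_sum, ← Finset.mul_sum]
  simp

/-- Spectral comparison for a block of rows of `S` multiplied by a bounded diagonal matrix. -/
lemma specSum_compress_le (S : Matrix ι ι ℂ) (P : ι → Prop) [DecidablePred P] (d : ι → ℝ) {L : ℝ}
    (hd0 : ∀ b, 0 ≤ d b) (hd : ∀ b, d b ≤ L) {ψ : ℝ → ℝ}
    (hψ : ConcaveOn ℝ (Set.Ici 0) ψ) (hm : MonotoneOn ψ (Set.Ici 0)) :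
    specSum ψ ((Matrix.of fun a b => if P a then S a b * (d b : ℂ) else 0)ᴴ *
        (Matrix.of fun a b => if P a then S a b * (d b : ℂ) else 0)) ≤
      specSum (fun t => ψ (L ^ 2 * t)) (Sᴴ * S) := by
  set D : Matrix ι ι ℂ := Matrix.diagonal fun b => (d b : ℂ) with hD
  set X : Matrix ι ι ℂ := Matrix.of fun a b => if P a then S a b * (d b : ℂ) else 0 with hX
  set Y : Matrix ι ι ℂ := Matrix.of fun a b => if P a then 0 else S a b * (d b : ℂ) with hY
  have hDH : Dᴴ = D := by
    rw [hD, Matrix.diagonal_conjTranspose]; congr 1; ext i; simp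
  have h1 : (S * D)ᴴ * (S * D) - Xᴴ * X = Yᴴ * Y := by
    ext i j
    simp only [Matrix.sub_apply, Matrix.mul_apply (M := (S * D)ᴴ), Matrix.mul_apply (M := Xᴴ),
      Matrix.mul_apply (M := Yᴴ), ← Finset.sum_sub_distrib, Matrix.conjTranspose_apply]
    refine Finset.sum_congr rfl fun a _ => ?_
    by_cases h : P a <;> simp [hX, hY, h, hD, Matrix.mul_diagonal]
  have h2 : ((L ^ 2 : ℝ) : ℂ) • (S * Sᴴ) - (S * D) * (S * D)ᴴ =
      S * Matrix.diagonal (fun b => ((L ^ 2 - d b ^ 2 : ℝ) : ℂ)) * Sᴴ := by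
    have e : Matrix.diagonal (fun b => ((L ^ 2 - d b ^ 2 : ℝ) : ℂ)) =
        ((L ^ 2 : ℝ) : ℂ) • (1 : Matrix ι ι ℂ) - D * D := by
      rw [hD, Matrix.diagonal_mul_diagonal]
      ext i j
      by_cases h : i = j
      · subst h; simp; ring
      · simp [h]
    rw [e, Matrix.conjTranspose_mul, hDH, Matrix.mul_sub, Matrix.sub_mul]
    simp [Matrix.mul_assoc]
  have h3 : (((L ^ 2 : ℝ) : ℂ) • (S * Sᴴ) - (S * D) * (S * D)ᴴ).PosSemidef := by
    rw [h2]
    refine Matrix.PosSemidef.mul_mul_conjTranspose_same ?_ S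
    refine Matrix.PosSemidef.diagonal (Pi.le_def.2 fun b => ?_)
    have : 0 ≤ L ^ 2 - d b ^ 2 := by nlinarith [hd0 b, hd b]
    rw [Pi.zero_apply]
    exact_mod_cast this
  calc specSum ψ (Xᴴ * X) ≤ specSum ψ ((S * D)ᴴ * (S * D)) :=
        specSum_mono (Matrix.posSemidef_conjTranspose_mul_self X)
          (by rw [h1]; exact Matrix.posSemidef_conjTranspose_mul_self Y) hψ hm
    _ = specSum ψ ((S * D) * (S * D)ᴴ) := specSum_mul_comm _ _ _
    _ ≤ specSum ψ (((L ^ 2 : ℝ) : ℂ) • (S * Sᴴ)) :=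
        specSum_mono (Matrix.posSemidef_self_mul_conjTranspose _) h3 hψ hm
    _ = specSum (fun t => ψ (L ^ 2 * t)) (S * Sᴴ) :=
        specSum_smul (Matrix.posSemidef_self_mul_conjTranspose S) _ _
    _ = _ := specSum_mul_comm _ _ _

lemma rpow_le_min_add {q c ω t : ℝ} (hq0 : 0 < q) (hq : q < 2) (hc : 0 < c) (hω : 0 < ω)
    (ht : 0 ≤ t) :
    t ^ (q / 2) ≤ min (t ^ (q / 2)) (c ^ q * ω) + c ^ (q - 2) * ω ^ (1 - 2 / q) * t := by
  rcases le_total (t ^ (q / 2)) (c ^ q * ω) with h | h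
  · rw [min_eq_left h]
    have : 0 ≤ c ^ (q - 2) * ω ^ (1 - 2 / q) * t := by positivity
    linarith
  · rw [min_eq_right h]
    have h1 : 0 < c ^ q * ω := by positivity
    have ht0 : 0 < t := by
      rcases ht.eq_or_lt with rfl | h'
      · rw [Real.zero_rpow (by positivity)] at h; linarith
      · exact h'
    have h2 : (t ^ (q / 2)) ^ (1 - 2 / q) ≤ (c ^ q * ω) ^ (1 - 2 / q) :=
      Real.rpow_le_rpow_of_nonpos h1 h (by
        rw [sub_nonpos, one_le_div hq0]; exact hq.le)
    rw [← Real.rpow_mul ht, Real.mul_rpow (by positivity) hω.le, ← Real.rpow_mul hc.le] at h2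
    have e1 : q / 2 * (1 - 2 / q) = q / 2 - 1 := by field_simp
    have e2 : q * (1 - 2 / q) = q - 2 := by field_simp
    rw [e1, e2, Real.rpow_sub_one ht0.ne', div_le_iff₀ ht0] at h2
    linarith

lemma specSum_row_multiplier_le {p q : ℝ} (hp : 0 < p) (hpq : p < q) (hq : q < 2) :
    ∃ C : ℝ, 0 < C ∧ ∀ {ι : Type} [Fintype ι] [DecidableEq ι] (S R : Matrix ι ι ℂ) (k : ι → ℕ)
      (d : ℕ → ι → ℝ) (c : ℝ), 0 < c → (∀ m b, 0 ≤ d m b) →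
      (∀ m b, d m b ≤ ((1 / 2 : ℝ) ^ m) ^ (-(1 / p - 1 / q))) →
      (∀ a b, R a b = S a b * (d (k a) b : ℂ)) →
      specSum (fun t => t ^ (q / 2)) (Rᴴ * R) ≤
        C * c ^ (q - p) * specSum (fun t => t ^ (p / 2)) (Sᴴ * S) +
          c ^ (q - 2) * ∑ a, ∑ b, ((1 / 2 : ℝ) ^ (k a)) ^ (1 - 2 / q) * Complex.normSq (R a b) := by
  obtain ⟨C, hC, hsum⟩ := sum_min_rpow_le hp hpq
  have hq0 : 0 < q := hp.trans hpq
  refine ⟨C, hC, fun {ι} _ _ S R k d c hc hd0 hd hR => ?_⟩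
  set K := Finset.univ.sup k + 1 with hK
  have hkK : ∀ a, k a ∈ Finset.range K := fun a => by
    rw [Finset.mem_range, hK, Nat.lt_succ_iff]; exact Finset.le_sup (Finset.mem_univ a)
  set X : ℕ → Matrix ι ι ℂ := fun m =>
    Matrix.of fun a b => if k a = m then S a b * (d m b : ℂ) else 0 with hX
  have hRX : Rᴴ * R = ∑ m ∈ Finset.range K, (X m)ᴴ * X m := by
    ext i j
    rw [Matrix.sum_apply, Matrix.mul_apply]
    simp only [Matrix.mul_apply]
    rw [Finset.sum_comm]
    refine Finset.sum_congr rfl fun a _ => ?_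
    rw [Finset.sum_eq_single_of_mem (k a) (hkK a)]
    · simp [hX, hR, Matrix.conjTranspose_apply]
    · intro m _ hm
      simp [hX, Ne.symm hm]
  have hcc : ∀ τ : ℝ, ConcaveOn ℝ (Set.Ici 0) fun t : ℝ => min (t ^ (q / 2)) τ := fun τ =>
    (concaveOn_rpow_Ici (by positivity) (by linarith)).inf (concaveOn_const τ (convex_Ici 0))
  have hmm : ∀ τ : ℝ, MonotoneOn (fun t : ℝ => min (t ^ (q / 2)) τ) (Set.Ici 0) :=
    fun τ x hx y hy hxy => min_le_min_right _
      (Real.rpow_le_rpow hx hxy (by positivity))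
  have hblock : ∀ m, specSum (fun t => t ^ (q / 2)) ((X m)ᴴ * X m) ≤
      specSum (fun t => min ((((((1 / 2 : ℝ) ^ m) ^ (-(1 / p - 1 / q))) ^ 2) * t) ^ (q / 2))
          (c ^ q * (1 / 2 : ℝ) ^ m)) (Sᴴ * S) +
        c ^ (q - 2) * ((1 / 2 : ℝ) ^ m) ^ (1 - 2 / q) *
          ∑ a, ∑ b, Complex.normSq (X m a b) := by
    intro m
    have hps := Matrix.posSemidef_conjTranspose_mul_self (X m)
    refine (specSum_le_specSum hps fun t ht => rpow_le_min_add hq0 hq hc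
      (show (0 : ℝ) < (1 / 2) ^ m by positivity) ht).trans ?_
    rw [specSum_add_mul hps, trace_gram_re]
    gcongr
    exact specSum_compress_le S (fun a => k a = m) (d m) (hd0 m) (hd m)
      (hcc (c ^ q * (1 / 2 : ℝ) ^ m)) (hmm _)
  rw [hRX]
  refine (specSum_sum_le _ (fun m => Matrix.posSemidef_conjTranspose_mul_self (X m))
    (concaveOn_rpow_Ici (by positivity) (by linarith))
    (Real.zero_rpow (by positivity))).trans ?_
  refine (Finset.sum_le_sum fun m _ => hblock m).trans ?_
  rw [Finset.sum_add_distrib]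
  refine add_le_add ?_ (le_of_eq ?_)
  · have hS := Matrix.posSemidef_conjTranspose_mul_self S
    simp_rw [specSum_eq_sum_eigenvalues _ hS.1]
    rw [Finset.sum_comm, Finset.mul_sum]
    exact Finset.sum_le_sum fun i _ => hsum K c _ hc (hS.eigenvalues_nonneg i)
  · simp_rw [mul_assoc]
    rw [← Finset.mul_sum]
    congr 1
    simp only [Finset.mul_sum]
    rw [Finset.sum_comm]
    refine Finset.sum_congr rfl fun a _ => ?_
    rw [Finset.sum_comm]
    refine Finset.sum_congr rfl fun b _ => ?_
    rw [Finset.sum_eq_single_of_mem (k a) (hkK a)]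
    · simp [hX, hR]
    · intro m _ hm
      simp [hX, Ne.symm hm]

end Blocks

lemma inv_add_mul_sq_le {p q ω v : ℝ} (hω : 0 < ω) (hv : 0 ≤ v) :
    ω ^ (1 - 2 / q) * ((ω ^ (1 / p - 1 / q) + v)⁻¹) ^ 2 ≤ ω ^ (1 - 2 / p) := by
  have h1 : (ω ^ (1 / p - 1 / q) + v)⁻¹ ≤ ω ^ (-(1 / p - 1 / q)) := by
    rw [Real.rpow_neg hω.le]
    exact inv_anti₀ (by positivity) (by linarith)
  calc _ ≤ ω ^ (1 - 2 / q) * (ω ^ (-(1 / p - 1 / q))) ^ 2 := by gcongr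
    _ = _ := by
      rw [← Real.rpow_natCast, ← Real.rpow_mul hω.le, ← Real.rpow_add hω]
      congr 1
      push_cast
      ring

/-- Division by `λ_a ^ δ + μ_b ^ δ` with dyadic weights maps `S_p` to `S_q`, up to a weighted
Hilbert-Schmidt term. -/
lemma specSum_schur_multiplier_le {p q : ℝ} (hp : 0 < p) (hpq : p < q) (hq : q < 2) :
    ∃ C : ℝ, 0 < C ∧ ∀ {ι : Type} [Fintype ι] [DecidableEq ι] (S Z : Matrix ι ι ℂ) (k l : ι → ℕ)
      (c : ℝ), 0 < c →
      (∀ a b, Z a b = S a b * (((((1 / 2 : ℝ) ^ k a) ^ (1 / p - 1 / q) +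
        ((1 / 2 : ℝ) ^ l b) ^ (1 / p - 1 / q))⁻¹ : ℝ) : ℂ)) →
      specSum (fun t => t ^ (q / 2)) (Zᴴ * Z) ≤
        C * (c ^ (q - p) * specSum (fun t => t ^ (p / 2)) (Sᴴ * S) +
          c ^ (q - 2) * ∑ a, ∑ b,
            ((1 / 2 : ℝ) ^ min (k a) (l b)) ^ (1 - 2 / p) * Complex.normSq (S a b)) := by
  obtain ⟨C, hC, hrow⟩ := specSum_row_multiplier_le hp hpq hq
  refine ⟨4 * C + 4, by positivity, fun {ι} _ _ S Z k l c hc hZ => ?_⟩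
  set δ := 1 / p - 1 / q with hδ
  set f : ℕ → ℕ → ℝ := fun m j => (((1 / 2 : ℝ) ^ m) ^ δ + ((1 / 2 : ℝ) ^ j) ^ δ)⁻¹ with hf
  have hf0 : ∀ m j, 0 ≤ f m j := fun m j => by positivity
  have hfm : ∀ m j, f m j ≤ ((1 / 2 : ℝ) ^ m) ^ (-δ) := fun m j => by
    rw [Real.rpow_neg (by positivity)]
    exact inv_anti₀ (by positivity) (le_add_of_nonneg_right (by positivity))
  have hfs : ∀ m j, f m j = f j m := fun m j => by simp only [hf, add_comm]
  have hsq : ∀ m j, ((1 / 2 : ℝ) ^ m) ^ (1 - 2 / q) * f m j ^ 2 ≤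
      ((1 / 2 : ℝ) ^ m) ^ (1 - 2 / p) := fun m j =>
    inv_add_mul_sq_le (by positivity) (by positivity)
  set d : ℕ → ι → ℝ := fun m b => if m ≤ l b then f m (l b) else 0 with hd
  set d' : ℕ → ι → ℝ := fun m a => if m < k a then f m (k a) else 0 with hd'
  set R : Matrix ι ι ℂ := Matrix.of fun a b => S a b * (d (k a) b : ℂ) with hR
  set T : Matrix ι ι ℂ := Matrix.of fun b a => Sᴴ b a * (d' (l b) a : ℂ) with hT
  have hZRT : Z = R + Tᴴ := by
    ext a b
    rw [hZ]
    by_cases h : k a ≤ l b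
    · simp [hR, hT, hd, hd', h, not_lt.2 h, hf, Matrix.conjTranspose_apply]
    · have hs := hfs (l b) (k a)
      simp only [hf] at hs
      simp only [hR, hT, hd, hd', h, not_le.1 h, Matrix.conjTranspose_apply, Matrix.add_apply,
        Matrix.of_apply, if_true, if_false, hf, hs]
      simp
  set E := ∑ a, ∑ b, ((1 / 2 : ℝ) ^ min (k a) (l b)) ^ (1 - 2 / p) * Complex.normSq (S a b)
    with hE
  have hRle := hrow S R k d c hc (fun m b => by simp only [hd]; split_ifs <;> simp [hf0])
    (fun m b => by
      simp only [hd]; split_ifs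
      · exact hfm _ _
      · positivity) (fun a b => rfl)
  have hTle := hrow Sᴴ T l d' c hc (fun m b => by simp only [hd']; split_ifs <;> simp [hf0])
    (fun m b => by
      simp only [hd']; split_ifs
      · exact hfm _ _
      · positivity) (fun a b => rfl)
  have hRE : ∑ a, ∑ b, ((1 / 2 : ℝ) ^ (k a)) ^ (1 - 2 / q) * Complex.normSq (R a b) ≤ E := by
    refine Finset.sum_le_sum fun a _ => Finset.sum_le_sum fun b _ => ?_
    simp only [hR, Matrix.of_apply, map_mul, Complex.normSq_ofReal]
    have := Complex.normSq_nonneg (S a b)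
    by_cases h : k a ≤ l b
    · simp only [hd, h, if_true, min_eq_left]
      calc _ = ((1 / 2 : ℝ) ^ (k a)) ^ (1 - 2 / q) * f (k a) (l b) ^ 2 *
            Complex.normSq (S a b) := by ring
        _ ≤ _ := mul_le_mul_of_nonneg_right (hsq _ _) this
    · simp only [hd, h, if_false, mul_zero]
      positivity
  have hTE : ∑ b, ∑ a, ((1 / 2 : ℝ) ^ (l b)) ^ (1 - 2 / q) * Complex.normSq (T b a) ≤ E := by
    rw [hE, Finset.sum_comm]
    refine Finset.sum_le_sum fun a _ => Finset.sum_le_sum fun b _ => ?_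
    simp only [hT, Matrix.of_apply, map_mul, Complex.normSq_ofReal, Matrix.conjTranspose_apply,
      Complex.star_def, Complex.normSq_conj]
    have := Complex.normSq_nonneg (S a b)
    by_cases h : l b < k a
    · simp only [hd', h, if_true, min_eq_right h.le]
      calc _ = ((1 / 2 : ℝ) ^ (l b)) ^ (1 - 2 / q) * f (l b) (k a) ^ 2 *
            Complex.normSq (S a b) := by ring
        _ ≤ _ := mul_le_mul_of_nonneg_right (hsq _ _) this
    · simp only [hd', h, if_false, mul_zero]
      positivity
  have hsum := specSum_gram_add_le (fun _ : Unit => R) (fun _ => Tᴴ) (s := q / 2) (by linarith)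
    (by linarith)
  simp only [Finset.univ_unique, Finset.sum_singleton, ← hZRT] at hsum
  rw [Matrix.conjTranspose_conjTranspose, specSum_mul_comm _ T Tᴴ] at hsum
  rw [Matrix.conjTranspose_conjTranspose, specSum_mul_comm _ S Sᴴ] at hTle
  have hE0 : 0 ≤ E := by
    refine Finset.sum_nonneg fun a _ => Finset.sum_nonneg fun b _ => ?_
    have := Complex.normSq_nonneg (S a b)
    positivity
  have hS0 := specSum_rpow_nonneg (Matrix.posSemidef_conjTranspose_mul_self S) (p / 2)
  have hc1 : 0 < c ^ (q - p) := by positivity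
  have hc2 : 0 < c ^ (q - 2) := by positivity
  have g1 := mul_le_mul_of_nonneg_left hRE hc2.le
  have g2 := mul_le_mul_of_nonneg_left hTE hc2.le
  have g3 : 0 ≤ C * (c ^ (q - 2) * E) := by positivity
  have g4 : 0 ≤ c ^ (q - p) * specSum (fun t => t ^ (p / 2)) (Sᴴ * S) := by positivity
  nlinarith

lemma gram_diag_re {ι κ : Type*} [Fintype ι] [Fintype κ] (C : κ → Matrix ι ι ℂ) (i : ι) :
    ((∑ j, (C j)ᴴ * C j) i i).re = ∑ j, ∑ a, Complex.normSq (C j a i) := by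
  rw [Matrix.sum_apply, Complex.re_sum]
  refine Finset.sum_congr rfl fun j _ => ?_
  rw [Matrix.mul_apply, Complex.re_sum]
  refine Finset.sum_congr rfl fun a _ => ?_
  rw [Matrix.conjTranspose_apply, Complex.star_def, mul_comm, Complex.mul_conj, Complex.ofReal_re]

section Lifting

variable {ι κ : Type*} [Fintype ι] [DecidableEq ι] [Fintype κ]

lemma specSum_gram_mul_diagonal_le {p q : ℝ} (hp : 0 < p) (hpq : p < q) (hq : q < 2)
    (hδ : 1 / p - 1 / q ≤ 1 / 2) (a : κ → Matrix ι ι ℂ) (μ : ι → ℝ) (hμ : ∀ b, 0 ≤ μ b) :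
    specSum (fun t => t ^ (p / 2))
        (∑ j, (a j * Matrix.diagonal fun b => ((μ b ^ (1 / p - 1 / q) : ℝ) : ℂ))ᴴ *
          (a j * Matrix.diagonal fun b => ((μ b ^ (1 / p - 1 / q) : ℝ) : ℂ))) ≤
      (specSum (fun t => t ^ (q / 2)) (∑ j, (a j)ᴴ * a j)) ^ (p / q) * (∑ b, μ b) ^ (1 - p / q) := by
  have hq0 : 0 < q := hp.trans hpq
  have hδ0 : 0 < 1 / p - 1 / q := sub_pos.2 (one_div_lt_one_div_of_lt hp hpq)
  set δ := 1 / p - 1 / q with hδdef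
  obtain ⟨V, ν, hV1, hV2, hν, hdiag, hspec⟩ := exists_unitary_diagonal (posSemidef_sum_gram a)
  set A := ∑ j, (a j)ᴴ * a j with hA
  set M : Matrix ι ι ℂ := Matrix.diagonal fun b => ((μ b ^ δ : ℝ) : ℂ) with hM
  set X : Matrix ι ι ℂ := Matrix.diagonal (fun i => ((√(ν i) : ℝ) : ℂ)) * Vᴴ with hX
  have hMH : Mᴴ = M := by
    rw [hM, Matrix.diagonal_conjTranspose]; congr 1; ext i; simp
  have hXX : Xᴴ * X = A := by
    have h1 : A = V * (Vᴴ * A * V) * Vᴴ := by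
      calc A = (V * Vᴴ) * A * (V * Vᴴ) := by rw [hV2]; simp
        _ = _ := by simp only [Matrix.mul_assoc]
    rw [h1, hdiag, hX, Matrix.conjTranspose_mul, Matrix.conjTranspose_conjTranspose,
      Matrix.diagonal_conjTranspose]
    have h2 : Matrix.diagonal (star fun i => ((√(ν i) : ℝ) : ℂ)) *
        Matrix.diagonal (fun i => ((√(ν i) : ℝ) : ℂ)) = Matrix.diagonal fun i => (ν i : ℂ) := by
      rw [Matrix.diagonal_mul_diagonal]
      congr 1
      ext i
      simp only [Pi.star_apply, Complex.star_def, Complex.conj_ofReal]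
      rw [← Complex.ofReal_mul, Real.mul_self_sqrt (hν i)]
    rw [← h2]
    simp only [Matrix.mul_assoc]
  have hlhs : ∑ j, (a j * M)ᴴ * (a j * M) = (X * M)ᴴ * (X * M) := by
    rw [Matrix.conjTranspose_mul, hMH]
    calc _ = M * A * M := by
          rw [hA, Finset.mul_sum, Finset.sum_mul]
          refine Finset.sum_congr rfl fun j _ => ?_
          rw [Matrix.conjTranspose_mul, hMH]
          simp only [Matrix.mul_assoc]
      _ = _ := by rw [← hXX]; simp only [Matrix.mul_assoc]
  set t : ι → ℝ := fun i => ∑ b, Complex.normSq (V b i) * μ b with ht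
  have ht0 : ∀ i, 0 ≤ t i := fun i =>
    Finset.sum_nonneg fun b _ => mul_nonneg (Complex.normSq_nonneg _) (hμ b)
  have hentry : ∀ i, (((X * M) * (X * M)ᴴ) i i).re ≤ ν i * t i ^ (2 * δ) := by
    intro i
    have h1 : (((X * M) * (X * M)ᴴ) i i).re =
        ν i * ∑ b, Complex.normSq (V b i) * μ b ^ (2 * δ) := by
      rw [Matrix.mul_apply, Complex.re_sum, Finset.mul_sum]
      refine Finset.sum_congr rfl fun b _ => ?_
      rw [Matrix.conjTranspose_apply, Complex.star_def, Complex.mul_conj, Complex.ofReal_re,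
        hX, hM, Matrix.mul_diagonal, Matrix.diagonal_mul, map_mul, map_mul, Complex.normSq_ofReal,
        Complex.normSq_ofReal, Real.mul_self_sqrt (hν i), Matrix.conjTranspose_apply,
        Complex.star_def, Complex.normSq_conj, ← sq, ← Real.rpow_natCast, ← Real.rpow_mul (hμ b)]
      push_cast
      rw [mul_comm δ 2]
      ring
    rw [h1]
    refine mul_le_mul_of_nonneg_left ?_ (hν i)
    have h2 := (concaveOn_rpow_Ici (s := 2 * δ) (by linarith) (by linarith)).le_map_sum
      (t := Finset.univ) (w := fun b => Complex.normSq (V b i)) (p := μ)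
      (fun b _ => Complex.normSq_nonneg _) (sum_normSq_col hV1 i) (fun b _ => hμ b)
    simpa only [smul_eq_mul] using h2
  have hsumt : ∑ i, t i = ∑ b, μ b := by
    simp only [ht]
    rw [Finset.sum_comm]
    refine Finset.sum_congr rfl fun b _ => ?_
    rw [← Finset.sum_mul, sum_normSq_row hV2 b, one_mul]
  have hps := Matrix.posSemidef_self_mul_conjTranspose (X * M)
  rw [hlhs, specSum_mul_comm, hspec, ← hsumt]
  refine (specSum_le_sum_diag hps (concaveOn_rpow_Ici (by linarith) (by linarith))).trans ?_
  refine le_trans (Finset.sum_le_sum fun i _ => ?_) (sum_rpow_mul_rpow_le Finset.univ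
    (fun i => ν i ^ (q / 2)) t (s := p / q) (by positivity) (by rwa [div_lt_one hq0])
    (fun i => Real.rpow_nonneg (hν i) _) ht0)
  refine (Real.rpow_le_rpow (diag_re_nonneg hps i) (hentry i) (by linarith)).trans (le_of_eq ?_)
  rw [Real.mul_rpow (hν i) (Real.rpow_nonneg (ht0 i) _), ← Real.rpow_mul (hν i),
    ← Real.rpow_mul (ht0 i)]
  congr 2
  · field_simp
  · rw [hδdef]; field_simp

/-- Left multiplication of a column family by `diag (λ ^ δ)` splits as column plus row. -/
lemma exists_diagonal_mul_decomposition {p q : ℝ} (hp : 0 < p) (hpq : p < q) (hq : q < 2)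
    (a : κ → Matrix ι ι ℂ) (lam : ι → ℝ) (hlam : ∀ b, 0 ≤ lam b) (hlam2 : ∑ b, lam b ≤ 2)
    {G : ℝ} (hG : 0 < G) (haG : specSum (fun t => t ^ (q / 2)) (∑ j, (a j)ᴴ * a j) ≤ G ^ q) :
    ∃ c r : κ → Matrix ι ι ℂ,
      (∀ j, (Matrix.diagonal fun b => ((lam b ^ (1 / p - 1 / q) : ℝ) : ℂ)) * a j = c j + r j) ∧
      specSum (fun t => t ^ (p / 2)) (∑ j, (c j)ᴴ * c j) ≤ G ^ p ∧
      specSum (fun t => t ^ (p / 2)) (∑ j, r j * (r j)ᴴ) ≤ 2 * G ^ p := by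
  have hq0 : 0 < q := hp.trans hpq
  have hδ0 : 0 < 1 / p - 1 / q := sub_pos.2 (one_div_lt_one_div_of_lt hp hpq)
  set δ := 1 / p - 1 / q with hδdef
  obtain ⟨V, ν, hV1, hV2, hν, hdiag, hspec⟩ := exists_unitary_diagonal (posSemidef_sum_gram a)
  rw [hspec] at haG
  set g : ι → ℝ := fun i => ν i ^ (q / 2) / G ^ q with hg
  have hGq : 0 < G ^ q := by positivity
  have hg0 : ∀ i, 0 ≤ g i := fun i => div_nonneg (Real.rpow_nonneg (hν i) _) hGq.le
  have hgsum : ∑ i, g i ≤ 1 := by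
    simp only [hg]
    rw [← Finset.sum_div, div_le_one hGq]
    exact haG
  set aV : κ → Matrix ι ι ℂ := fun j => a j * V with hat
  have hatν : ∀ i, ∑ j, ∑ b, Complex.normSq (aV j b i) = ν i := by
    intro i
    rw [← gram_diag_re]
    have : ∑ j, (aV j)ᴴ * aV j = Vᴴ * (∑ j, (a j)ᴴ * a j) * V := by
      rw [Finset.mul_sum, Finset.sum_mul]
      refine Finset.sum_congr rfl fun j _ => ?_
      simp only [hat, Matrix.conjTranspose_mul, Matrix.mul_assoc]
    rw [this, hdiag, Matrix.diagonal_apply_eq, Complex.ofReal_re]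
  have hrec : ∀ j, aV j * Vᴴ = a j := fun j => by
    simp only [hat]
    rw [Matrix.mul_assoc, hV2, Matrix.mul_one]
  set C : κ → Matrix ι ι ℂ := fun j => Matrix.of fun b i =>
    if lam b ≤ g i then ((lam b ^ δ : ℝ) : ℂ) * aV j b i else 0 with hC
  set T : κ → Matrix ι ι ℂ := fun j => Matrix.of fun b i =>
    if lam b ≤ g i then 0 else ((lam b ^ δ : ℝ) : ℂ) * aV j b i with hT
  have hCT : ∀ j, (Matrix.diagonal fun b => ((lam b ^ δ : ℝ) : ℂ)) * aV j = C j + T j := by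
    intro j
    ext b i
    rw [Matrix.diagonal_mul]
    by_cases h : lam b ≤ g i <;> simp [hC, hT, h]
  refine ⟨fun j => C j * Vᴴ, fun j => T j * Vᴴ, fun j => ?_, ?_, ?_⟩
  · rw [← Matrix.add_mul, ← hCT, Matrix.mul_assoc, hrec]
  · have h1 : ∑ j, (C j * Vᴴ)ᴴ * (C j * Vᴴ) = Vᴴᴴ * (∑ j, (C j)ᴴ * C j) * Vᴴ := by
      rw [Finset.mul_sum, Finset.sum_mul]
      refine Finset.sum_congr rfl fun j _ => ?_
      simp only [Matrix.conjTranspose_mul, Matrix.mul_assoc]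
    rw [h1, specSum_conj _ _ (by rw [Matrix.conjTranspose_conjTranspose, hV1])]
    have hps := posSemidef_sum_gram C
    refine (specSum_le_sum_diag hps (concaveOn_rpow_Ici (by linarith) (by linarith))).trans ?_
    have hbd : ∀ i, ((∑ j, (C j)ᴴ * C j) i i).re ≤ g i ^ (2 * δ) * ν i := by
      intro i
      rw [gram_diag_re, ← hatν i, Finset.mul_sum]
      refine Finset.sum_le_sum fun j _ => ?_
      rw [Finset.mul_sum]
      refine Finset.sum_le_sum fun b _ => ?_
      have h0 := Complex.normSq_nonneg (aV j b i)
      by_cases h : lam b ≤ g i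
      · simp only [hC, Matrix.of_apply, h, if_true, map_mul, Complex.normSq_ofReal]
        refine mul_le_mul_of_nonneg_right ?_ h0
        rw [← sq, ← Real.rpow_natCast, ← Real.rpow_mul (hlam b), mul_comm]
        push_cast
        exact Real.rpow_le_rpow (hlam b) h (by positivity)
      · simp only [hC, Matrix.of_apply, h, if_false, map_zero]
        exact mul_nonneg (Real.rpow_nonneg (hg0 i) _) h0
    refine le_trans (Finset.sum_le_sum fun i _ => ?_) ((sum_rpow_mul_rpow_le Finset.univ
      (fun i => ν i ^ (q / 2)) g (s := p / q) (by positivity) (by rwa [div_lt_one hq0])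
      (fun i => Real.rpow_nonneg (hν i) _) hg0).trans ?_)
    · refine (Real.rpow_le_rpow (diag_re_nonneg hps i) (hbd i) (by linarith)).trans (le_of_eq ?_)
      rw [Real.mul_rpow (Real.rpow_nonneg (hg0 i) _) (hν i), ← Real.rpow_mul (hν i),
        ← Real.rpow_mul (hg0 i), mul_comm]
      congr 2
      · field_simp
      · rw [hδdef]; field_simp
    · have e : (G ^ q) ^ (p / q) = G ^ p := by
        rw [← Real.rpow_mul hG.le]; congr 1; field_simp
      calc _ ≤ (G ^ q) ^ (p / q) * 1 := by
            refine mul_le_mul (Real.rpow_le_rpow (Finset.sum_nonneg fun i _ =>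
              Real.rpow_nonneg (hν i) _) haG (by positivity)) ?_
              (Real.rpow_nonneg (Finset.sum_nonneg fun i _ => hg0 i) _) (by positivity)
            refine Real.rpow_le_one (Finset.sum_nonneg fun i _ => hg0 i) hgsum ?_
            rw [sub_nonneg, div_le_one hq0]
            exact hpq.le
        _ = _ := by rw [e, mul_one]
  · have h1 : ∑ j, (T j * Vᴴ) * (T j * Vᴴ)ᴴ = ∑ j, ((T j)ᴴ)ᴴ * (T j)ᴴ := by
      refine Finset.sum_congr rfl fun j _ => ?_
      rw [Matrix.conjTranspose_mul, Matrix.conjTranspose_conjTranspose, Matrix.mul_assoc,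
        ← Matrix.mul_assoc Vᴴ, hV1, Matrix.one_mul, Matrix.conjTranspose_conjTranspose]
    rw [h1]
    have hps := posSemidef_sum_gram fun j => (T j)ᴴ
    refine (specSum_le_sum_diag hps (concaveOn_rpow_Ici (by linarith) (by linarith))).trans ?_
    set W : ι → ℝ := fun b => ∑ j, ∑ i, Complex.normSq (aV j b i) * g i ^ (1 - 2 / q) with hW
    have hW0 : ∀ b, 0 ≤ W b := fun b => Finset.sum_nonneg fun j _ => Finset.sum_nonneg fun i _ =>
      mul_nonneg (Complex.normSq_nonneg _) (Real.rpow_nonneg (hg0 i) _)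
    have hz : ∀ j b i, ν i = 0 → aV j b i = 0 := by
      intro j b i h
      have h2 := hatν i
      rw [h, Finset.sum_eq_zero_iff_of_nonneg (fun j _ => Finset.sum_nonneg fun b _ =>
        Complex.normSq_nonneg _)] at h2
      have h3 := h2 j (Finset.mem_univ j)
      rw [Finset.sum_eq_zero_iff_of_nonneg (fun b _ => Complex.normSq_nonneg _)] at h3
      exact Complex.normSq_eq_zero.1 (h3 b (Finset.mem_univ b))
    have hbd : ∀ b, ((∑ j, ((T j)ᴴ)ᴴ * (T j)ᴴ) b b).re ≤ W b * lam b ^ (2 / p - 1) := by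
      intro b
      rw [gram_diag_re, hW, Finset.sum_mul]
      refine Finset.sum_le_sum fun j _ => ?_
      rw [Finset.sum_mul]
      refine Finset.sum_le_sum fun i _ => ?_
      rw [Matrix.conjTranspose_apply, Complex.star_def, Complex.normSq_conj]
      have h0 := Complex.normSq_nonneg (aV j b i)
      by_cases h : lam b ≤ g i
      · simp only [hT, Matrix.of_apply, h, if_true, map_zero]
        exact mul_nonneg (mul_nonneg h0 (Real.rpow_nonneg (hg0 i) _))
          (Real.rpow_nonneg (hlam b) _)
      · simp only [hT, Matrix.of_apply, h, if_false, map_mul, Complex.normSq_ofReal]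
        rcases (hν i).eq_or_lt with h' | h'
        · simp [hz j b i h'.symm]
        · have hgi : 0 < g i := div_pos (Real.rpow_pos_of_pos h' _) hGq
          have hl : 0 < lam b := hgi.trans (not_le.1 h)
          have h4 : lam b ^ (1 - 2 / q) ≤ g i ^ (1 - 2 / q) :=
            Real.rpow_le_rpow_of_nonpos hgi (not_le.1 h).le (by
              rw [sub_nonpos, one_le_div hq0]; exact hq.le)
          have h5 : lam b ^ δ * lam b ^ δ = lam b ^ (1 - 2 / q) * lam b ^ (2 / p - 1) := by
            rw [← Real.rpow_add hl, ← Real.rpow_add hl, hδdef]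
            congr 1
            ring
          rw [h5, mul_comm (_ * _), mul_assoc (Complex.normSq _)]
          exact mul_le_mul_of_nonneg_left (mul_le_mul_of_nonneg_right h4 (by positivity)) h0
    have hWsum : ∑ b, W b ≤ G ^ (2 : ℝ) := by
      have h2 : ∑ b, W b = ∑ i, ν i * g i ^ (1 - 2 / q) := by
        simp only [hW]
        simp_rw [← hatν, Finset.sum_mul]
        rw [Finset.sum_comm]
        simp_rw [Finset.sum_comm (s := (Finset.univ : Finset ι)) (t := (Finset.univ : Finset κ))]
        refine Finset.sum_congr rfl fun j _ => Finset.sum_comm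
      rw [h2]
      calc ∑ i, ν i * g i ^ (1 - 2 / q) ≤ ∑ i, G ^ (2 - q) * ν i ^ (q / 2) := by
            refine Finset.sum_le_sum fun i _ => le_of_eq ?_
            rcases (hν i).eq_or_lt with h' | h'
            · rw [← h', zero_mul, Real.zero_rpow (by positivity), mul_zero]
            · simp only [hg]
              rw [Real.div_rpow (by positivity) hGq.le, ← Real.rpow_mul h'.le,
                ← Real.rpow_mul hG.le]
              have e1 : q / 2 * (1 - 2 / q) = q / 2 - 1 := by field_simp
              have e2 : q * (1 - 2 / q) = -(2 - q) := by field_simp; ring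
              rw [e1, e2, Real.rpow_neg hG.le, Real.rpow_sub_one h'.ne']
              field_simp
        _ = G ^ (2 - q) * ∑ i, ν i ^ (q / 2) := by rw [Finset.mul_sum]
        _ ≤ G ^ (2 - q) * G ^ q := by gcongr
        _ = _ := by rw [← Real.rpow_add hG]; congr 1; ring
    refine le_trans (Finset.sum_le_sum fun b _ => ?_) ((sum_rpow_mul_rpow_le Finset.univ
      W lam (s := p / 2) (by positivity) (by linarith) hW0 hlam).trans ?_)
    · refine (Real.rpow_le_rpow (diag_re_nonneg hps b) (hbd b) (by linarith)).trans (le_of_eq ?_)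
      rw [Real.mul_rpow (hW0 b) (Real.rpow_nonneg (hlam b) _), ← Real.rpow_mul (hlam b)]
      congr 2
      field_simp
    · have e : (G ^ (2 : ℝ)) ^ (p / 2) = G ^ p := by
        rw [← Real.rpow_mul hG.le]; congr 1; field_simp
      calc _ ≤ (G ^ (2 : ℝ)) ^ (p / 2) * 2 := by
            refine mul_le_mul (Real.rpow_le_rpow (Finset.sum_nonneg fun b _ => hW0 b) hWsum
              (by positivity)) ?_ (Real.rpow_nonneg (Finset.sum_nonneg fun i _ => hlam i) _)
              (by positivity)
            calc (∑ b, lam b) ^ (1 - p / 2) ≤ 2 ^ (1 - p / 2) :=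
                  Real.rpow_le_rpow (Finset.sum_nonneg fun i _ => hlam i) hlam2 (by linarith)
              _ ≤ 2 ^ (1 : ℝ) := Real.rpow_le_rpow_of_exponent_le (by norm_num) (by linarith)
              _ = 2 := Real.rpow_one 2
        _ = _ := by rw [e, mul_comm]

end Lifting

section TripleNorm

variable {n N : ℕ}

lemma tripleNorm_le {p : ℝ} (hp : 0 < p) {x a b : Fin N → Matrix (Fin n) (Fin n) ℂ}
    (hx : ∀ k, x k = a k + b k) {u : ℝ} (hu : 0 ≤ u)
    (ha : specSum (fun t => t ^ (p / 2)) (∑ k, (a k)ᴴ * a k) ≤ u ^ p)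
    (hb : specSum (fun t => t ^ (p / 2)) (∑ k, b k * (b k)ᴴ) ≤ u ^ p) :
    tripleNorm p x ≤ 2 * u := by
  have hA := posSemidef_sum_gram a
  have hB : (∑ k, b k * (b k)ᴴ).PosSemidef := by
    simpa using posSemidef_sum_gram fun k => (b k)ᴴ
  have hroot : ∀ v : ℝ, 0 ≤ v → v ≤ u ^ p → v ^ (1 / p) ≤ u := by
    intro v hv h
    calc v ^ (1 / p) ≤ (u ^ p) ^ (1 / p) := Real.rpow_le_rpow hv h (by positivity)
      _ = u := by rw [← Real.rpow_mul hu, mul_one_div_cancel hp.ne', Real.rpow_one]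
  rw [tripleNorm]
  refine (csInf_le ⟨0, ?_⟩ (Set.mem_ofPred.2 ⟨a, b, hx, rfl⟩)).trans ?_
  · rintro r ⟨a, b, -, rfl⟩
    have hB : (∑ k, b k * (b k)ᴴ).PosSemidef := by
      simpa using posSemidef_sum_gram fun k => (b k)ᴴ
    rw [schattenNorm_posPow_half _ (posSemidef_sum_gram a), schattenNorm_posPow_half _ hB]
    exact add_nonneg (Real.rpow_nonneg (specSum_rpow_nonneg (posSemidef_sum_gram a) _) _)
      (Real.rpow_nonneg (specSum_rpow_nonneg hB _) _)
  · rw [schattenNorm_posPow_half _ hA, schattenNorm_posPow_half _ hB]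
    have h1 := hroot _ (specSum_rpow_nonneg hA _) ha
    have h2 := hroot _ (specSum_rpow_nonneg hB _) hb
    linarith

lemma exists_decomposition_of_tripleNorm_lt {p : ℝ} (hp : 0 < p)
    {x : Fin N → Matrix (Fin n) (Fin n) ℂ} {u : ℝ} (h : tripleNorm p x < u) :
    ∃ a b : Fin N → Matrix (Fin n) (Fin n) ℂ, (∀ k, x k = a k + b k) ∧
      specSum (fun t => t ^ (p / 2)) (∑ k, (a k)ᴴ * a k) ≤ u ^ p ∧
      specSum (fun t => t ^ (p / 2)) (∑ k, b k * (b k)ᴴ) ≤ u ^ p := by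
  rw [tripleNorm] at h
  obtain ⟨r, ⟨a, b, hx, rfl⟩, hr⟩ :=
    exists_lt_of_csInf_lt ⟨_, Set.mem_ofPred.2 ⟨x, 0, fun k => by simp, rfl⟩⟩ h
  have hA := posSemidef_sum_gram a
  have hB : (∑ k, b k * (b k)ᴴ).PosSemidef := by
    simpa using posSemidef_sum_gram fun k => (b k)ᴴ
  rw [schattenNorm_posPow_half _ hA, schattenNorm_posPow_half _ hB] at hr
  have hA0 := specSum_rpow_nonneg hA (p / 2)
  have hB0 := specSum_rpow_nonneg hB (p / 2)
  have hroot : ∀ v : ℝ, 0 ≤ v → v ^ (1 / p) ≤ u → v ≤ u ^ p := by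
    intro v hv h
    calc v = (v ^ (1 / p)) ^ p := by
          rw [← Real.rpow_mul hv, one_div_mul_cancel hp.ne', Real.rpow_one]
      _ ≤ u ^ p := Real.rpow_le_rpow (by positivity) h hp.le
  refine ⟨a, b, hx, hroot _ hA0 ?_, hroot _ hB0 ?_⟩
  · have := Real.rpow_nonneg hB0 (1 / p); linarith
  · have := Real.rpow_nonneg hA0 (1 / p); linarith

end TripleNorm

section Lifting

variable {ι κ : Type*} [Fintype ι] [DecidableEq ι] [Fintype κ]

/-- A column family multiplied by the weight `λ_a ^ δ + μ_b ^ δ` splits as column plus row. -/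
lemma exists_column_lifting {p q : ℝ} (hp : 0 < p) (hpq : p < q) (hq : q < 2)
    (hδ : 1 / p - 1 / q ≤ 1 / 2) (a : κ → Matrix ι ι ℂ) (lam μ : ι → ℝ)
    (hlam : ∀ b, 0 ≤ lam b) (hμ : ∀ b, 0 ≤ μ b) (hlam2 : ∑ b, lam b ≤ 2) (hμ2 : ∑ b, μ b ≤ 2)
    {G : ℝ} (hG : 0 < G) (haG : specSum (fun t => t ^ (q / 2)) (∑ j, (a j)ᴴ * a j) ≤ G ^ q) :
    ∃ c r : κ → Matrix ι ι ℂ,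
      (∀ j, (Matrix.diagonal fun b => ((lam b ^ (1 / p - 1 / q) : ℝ) : ℂ)) * a j +
        a j * (Matrix.diagonal fun b => ((μ b ^ (1 / p - 1 / q) : ℝ) : ℂ)) = c j + r j) ∧
      specSum (fun t => t ^ (p / 2)) (∑ j, (c j)ᴴ * c j) ≤ 6 * G ^ p ∧
      specSum (fun t => t ^ (p / 2)) (∑ j, r j * (r j)ᴴ) ≤ 2 * G ^ p := by
  have hq0 : 0 < q := hp.trans hpq
  obtain ⟨c, r, h1, h2, h3⟩ := exists_diagonal_mul_decomposition hp hpq hq a lam hlam hlam2 hG haG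
  refine ⟨fun j => c j + a j * (Matrix.diagonal fun b => ((μ b ^ (1 / p - 1 / q) : ℝ) : ℂ)), r,
    fun j => ?_, ?_, h3⟩
  · simp only [h1, add_right_comm]
  · have h4 := specSum_gram_mul_diagonal_le hp hpq hq hδ a μ hμ
    have h5 := specSum_gram_add_le c (fun j => a j *
      (Matrix.diagonal fun b => ((μ b ^ (1 / p - 1 / q) : ℝ) : ℂ))) (s := p / 2) (by linarith)
      (by linarith)
    have e : (G ^ q) ^ (p / q) = G ^ p := by
      rw [← Real.rpow_mul hG.le]; congr 1; field_simp
    have h6 : (specSum (fun t => t ^ (q / 2)) (∑ j, (a j)ᴴ * a j)) ^ (p / q) *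
        (∑ b, μ b) ^ (1 - p / q) ≤ G ^ p * 2 := by
      have hpq' : p / q ≤ 1 := (div_le_one hq0).2 hpq.le
      have hμ0 : 0 ≤ ∑ b, μ b := Finset.sum_nonneg fun b _ => hμ b
      rw [← e]
      refine mul_le_mul (Real.rpow_le_rpow (specSum_rpow_nonneg (posSemidef_sum_gram a) _) haG
        (by positivity)) ?_ (Real.rpow_nonneg hμ0 _) (by positivity)
      calc (∑ b, μ b) ^ (1 - p / q) ≤ 2 ^ (1 - p / q) :=
            Real.rpow_le_rpow hμ0 hμ2 (by linarith)
        _ ≤ 2 ^ (1 : ℝ) := Real.rpow_le_rpow_of_exponent_le (by norm_num)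
            (by have : 0 ≤ p / q := by positivity
                linarith)
        _ = 2 := Real.rpow_one 2
    linarith

end Lifting

/-- If `x_j (a, b) = (λ_a ^ δ + μ_b ^ δ) z_j (a, b)` then `|||x|||_p` is controlled by
`|||z|||_q`. -/
lemma tripleNorm_lifting_le {p q : ℝ} (hp : 0 < p) (hpq : p < q) (hq : q < 2)
    (hδ : 1 / p - 1 / q ≤ 1 / 2) {n N : ℕ} (x z : Fin N → Matrix (Fin n) (Fin n) ℂ)
    (lam μ : Fin n → ℝ) (hlam : ∀ b, 0 ≤ lam b) (hμ : ∀ b, 0 ≤ μ b)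
    (hlam2 : ∑ b, lam b ≤ 2) (hμ2 : ∑ b, μ b ≤ 2)
    (hxz : ∀ j, x j = (Matrix.diagonal fun b => ((lam b ^ (1 / p - 1 / q) : ℝ) : ℂ)) * z j +
        z j * (Matrix.diagonal fun b => ((μ b ^ (1 / p - 1 / q) : ℝ) : ℂ)))
    {G : ℝ} (hG : 0 < G) (hz : tripleNorm q z < G) :
    tripleNorm p x ≤ 2 * (16 ^ (1 / p) * G) := by
  have hq0 : 0 < q := hp.trans hpq
  obtain ⟨a, b, hzab, ha, hb⟩ := exists_decomposition_of_tripleNorm_lt hq0 hz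
  obtain ⟨c, r, hcr, hc, hr⟩ := exists_column_lifting hp hpq hq hδ a lam μ hlam hμ hlam2 hμ2 hG ha
  obtain ⟨c', r', hcr', hc', hr'⟩ := exists_column_lifting hp hpq hq hδ (fun j => (b j)ᴴ) μ lam
    hμ hlam hμ2 hlam2 hG (by simpa using hb)
  have hadj : ∀ v : Fin n → ℝ,
      (Matrix.diagonal fun b => ((v b ^ (1 / p - 1 / q) : ℝ) : ℂ))ᴴ =
        Matrix.diagonal fun b => ((v b ^ (1 / p - 1 / q) : ℝ) : ℂ) := by
    intro v
    rw [Matrix.diagonal_conjTranspose]; congr 1; ext i; simp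
  have hG16 : (16 ^ (1 / p) * G) ^ p = 16 * G ^ p := by
    rw [Real.mul_rpow (by positivity) hG.le, ← Real.rpow_mul (by norm_num),
      one_div_mul_cancel hp.ne', Real.rpow_one]
  refine tripleNorm_le hp (a := fun j => c j + (r' j)ᴴ) (b := fun j => r j + (c' j)ᴴ)
    (fun j => ?_) (by positivity) ?_ ?_
  · have h := congrArg Matrix.conjTranspose (hcr' j)
    simp only [Matrix.conjTranspose_add, Matrix.conjTranspose_mul,
      Matrix.conjTranspose_conjTranspose, hadj] at h
    rw [hxz, hzab, Matrix.mul_add, Matrix.add_mul]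
    calc _ = (Matrix.diagonal (fun b => ((lam b ^ (1 / p - 1 / q) : ℝ) : ℂ)) * a j +
          a j * Matrix.diagonal fun b => ((μ b ^ (1 / p - 1 / q) : ℝ) : ℂ)) +
          (b j * Matrix.diagonal (fun b => ((μ b ^ (1 / p - 1 / q) : ℝ) : ℂ)) +
          Matrix.diagonal (fun b => ((lam b ^ (1 / p - 1 / q) : ℝ) : ℂ)) * b j) := by abel
      _ = _ := by rw [hcr, h]; abel
  · rw [hG16]
    have h5 := specSum_gram_add_le c (fun j => (r' j)ᴴ) (s := p / 2) (by linarith) (by linarith)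
    simp only [Matrix.conjTranspose_conjTranspose] at h5
    linarith
  · rw [hG16]
    have h5 := specSum_gram_add_le (fun j => (r j)ᴴ) c' (s := p / 2) (by linarith) (by linarith)
    simp only [Matrix.conjTranspose_conjTranspose] at h5
    have e : ∑ j, (r j + (c' j)ᴴ) * (r j + (c' j)ᴴ)ᴴ = ∑ j, ((r j)ᴴ + c' j)ᴴ * ((r j)ᴴ + c' j) := by
      simp
    rw [e]
    linarith

section Invariance

variable {n N : ℕ}

lemma tripleNorm_le_of_unitary {p : ℝ} (hp : 0 < p) {x y : Fin N → Matrix (Fin n) (Fin n) ℂ}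
    {U V : Matrix (Fin n) (Fin n) ℂ} (hU : Uᴴ * U = 1) (hV : Vᴴ * V = 1)
    (hxy : ∀ k, x k = U * y k * Vᴴ) {u : ℝ} (hu : 0 ≤ u) (h : tripleNorm p y < u) :
    tripleNorm p x ≤ 2 * u := by
  obtain ⟨a, b, hyab, ha, hb⟩ := exists_decomposition_of_tripleNorm_lt hp h
  refine tripleNorm_le hp (a := fun k => U * a k * Vᴴ) (b := fun k => U * b k * Vᴴ)
    (fun k => by rw [hxy, hyab, Matrix.mul_add, Matrix.add_mul]) hu ?_ ?_
  · have h1 : ∑ k, (U * a k * Vᴴ)ᴴ * (U * a k * Vᴴ) = Vᴴᴴ * (∑ k, (a k)ᴴ * a k) * Vᴴ := by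
      rw [Finset.mul_sum, Finset.sum_mul]
      refine Finset.sum_congr rfl fun j _ => ?_
      calc _ = Vᴴᴴ * (a j)ᴴ * (Uᴴ * U) * a j * Vᴴ := by
            simp only [Matrix.conjTranspose_mul, Matrix.mul_assoc]
        _ = _ := by rw [hU, Matrix.mul_one, Matrix.mul_assoc Vᴴᴴ]
    rw [h1, specSum_conj _ _ (by rw [Matrix.conjTranspose_conjTranspose, hV])]
    exact ha
  · have h1 : ∑ k, (U * b k * Vᴴ) * (U * b k * Vᴴ)ᴴ = Uᴴᴴ * (∑ k, b k * (b k)ᴴ) * Uᴴ := by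
      rw [Finset.mul_sum, Finset.sum_mul]
      refine Finset.sum_congr rfl fun j _ => ?_
      calc _ = U * b j * (Vᴴ * V) * (b j)ᴴ * Uᴴ := by
            simp only [Matrix.conjTranspose_mul, Matrix.conjTranspose_conjTranspose,
              Matrix.mul_assoc]
        _ = _ := by
          rw [hV, Matrix.mul_one, Matrix.mul_assoc U, Matrix.conjTranspose_conjTranspose]
    rw [h1, specSum_conj _ _ (by rw [Matrix.conjTranspose_conjTranspose, hU])]
    exact hb

lemma radAvg_eq {p : ℝ} (hp : 0 < p) (x : Fin N → Matrix (Fin n) (Fin n) ℂ) :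
    radAvg p x = (1 / 2 ^ N) * ∑ ε : Fin N → Bool, specSum (fun t => t ^ (p / 2))
      ((∑ k, (if ε k then (1 : ℂ) else -1) • x k)ᴴ *
        ∑ k, (if ε k then (1 : ℂ) else -1) • x k) := by
  rw [radAvg]
  refine congrArg _ (Finset.sum_congr rfl fun ε _ => ?_)
  rw [schattenNorm_rpow hp]

lemma radAvg_nonneg {p : ℝ} (hp : 0 < p) (x : Fin N → Matrix (Fin n) (Fin n) ℂ) :
    0 ≤ radAvg p x := by
  rw [radAvg_eq hp]
  exact mul_nonneg (by positivity) (Finset.sum_nonneg fun ε _ =>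
    specSum_rpow_nonneg (Matrix.posSemidef_conjTranspose_mul_self _) _)

lemma radAvg_unitary {p : ℝ} (hp : 0 < p) (x : Fin N → Matrix (Fin n) (Fin n) ℂ)
    {U V : Matrix (Fin n) (Fin n) ℂ} (hU : U * Uᴴ = 1) (hV : V * Vᴴ = 1) :
    radAvg p (fun k => Uᴴ * x k * V) = radAvg p x := by
  rw [radAvg_eq hp, radAvg_eq hp]
  refine congrArg _ (Finset.sum_congr rfl fun ε _ => ?_)
  set S := ∑ k, (if ε k then (1 : ℂ) else -1) • x k with hS
  have h1 : ∑ k, (if ε k then (1 : ℂ) else -1) • (Uᴴ * x k * V) = Uᴴ * S * V := by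
    rw [hS, Finset.mul_sum, Finset.sum_mul]
    simp only [Matrix.mul_smul, Matrix.smul_mul]
  have h2 : (Uᴴ * S * V)ᴴ * (Uᴴ * S * V) = Vᴴ * (Sᴴ * S) * V := by
    calc _ = Vᴴ * Sᴴ * (U * Uᴴ) * S * V := by
          simp only [Matrix.conjTranspose_mul, Matrix.conjTranspose_conjTranspose,
            Matrix.mul_assoc]
      _ = _ := by rw [hU, Matrix.mul_one, Matrix.mul_assoc Vᴴ]
  rw [h1, h2, specSum_conj _ _ hV]

end Invariance

lemma sum_signs_normSq (N : ℕ) (c : Fin N → ℂ) :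
    ∑ ε : Fin N → Bool, Complex.normSq (∑ k, (if ε k then (1 : ℂ) else -1) * c k) =
      2 ^ N * ∑ k, Complex.normSq (c k) := by
  induction N with
  | zero => simp
  | succ N ih =>
    rw [← (Fin.consEquiv fun _ : Fin (N + 1) => Bool).sum_comp, Fintype.sum_prod_type,
      Finset.sum_comm, Fin.sum_univ_succ (fun k => Complex.normSq (c k)), mul_add, pow_succ',
      mul_assoc, mul_assoc, ← ih fun k => c k.succ, Finset.mul_sum]
    have h1 : (2 : ℝ) * (2 ^ N * Complex.normSq (c 0)) =
        ∑ _ε : Fin N → Bool, 2 * Complex.normSq (c 0) := by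
      simp; ring
    rw [h1, ← Finset.sum_add_distrib]
    refine Finset.sum_congr rfl fun ε _ => ?_
    simp only [Fintype.univ_bool, Fin.sum_univ_succ]
    simp [Fin.consEquiv, Complex.normSq_apply]
    ring

lemma exists_dyadic_weights {ι : Type*} [Fintype ι] {p T : ℝ} (hp : 0 < p) (hT : 0 < T)
    (ν : ι → ℝ) (hν : ∀ i, 0 ≤ ν i) (hsum : ∑ i, ν i ^ (p / 2) ≤ T ^ p) :
    ∃ l : ι → ℕ, ∑ i, (1 / 2 : ℝ) ^ l i ≤ 2 ∧
      ∑ i, ((1 / 2 : ℝ) ^ l i) ^ (1 - 2 / p) * ν i ≤ 2 * (2 ^ (2 / p) * T ^ 2) := by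
  have hTp : 0 < T ^ p := by positivity
  set w : ι → ℝ := fun i => (ν i ^ (p / 2) / T ^ p + 1 / Fintype.card ι) / 2 with hw
  have hcard : ∀ i : ι, (0 : ℝ) < 1 / Fintype.card ι := fun i => by
    have : Nonempty ι := ⟨i⟩
    positivity
  have hν' : ∀ i, 0 ≤ ν i ^ (p / 2) / T ^ p := fun i =>
    div_nonneg (Real.rpow_nonneg (hν i) _) hTp.le
  have hw0 : ∀ i, 0 < w i := fun i => by
    have := hcard i
    have := hν' i
    simp only [hw]
    positivity
  have hwsum : ∑ i, w i ≤ 1 := by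
    simp only [hw]
    rw [← Finset.sum_div, Finset.sum_add_distrib, ← Finset.sum_div]
    have h1 : (∑ i, ν i ^ (p / 2)) / T ^ p ≤ 1 := (div_le_one hTp).2 hsum
    have h2 : ∑ _i : ι, (1 : ℝ) / Fintype.card ι ≤ 1 := by
      simp only [Finset.sum_const, Finset.card_univ, nsmul_eq_mul]
      rw [mul_one_div]
      exact div_self_le_one _
    linarith
  have hw1 : ∀ i, w i ≤ 1 := fun i =>
    (Finset.single_le_sum (fun i _ => (hw0 i).le) (Finset.mem_univ i)).trans hwsum
  choose l hl1 hl2 using fun i => exists_nat_pow_near_of_lt_one (hw0 i) (hw1 i)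
    (show (0 : ℝ) < 1 / 2 by norm_num) (by norm_num)
  have hle : ∑ i, (1 / 2 : ℝ) ^ l i ≤ 2 := by
    calc ∑ i, (1 / 2 : ℝ) ^ l i ≤ ∑ i, 2 * w i := Finset.sum_le_sum fun i _ => by
          have := hl1 i
          rw [pow_succ] at this
          linarith
      _ = 2 * ∑ i, w i := by rw [Finset.mul_sum]
      _ ≤ 2 := by linarith
  refine ⟨l, hle, ?_⟩
  calc ∑ i, ((1 / 2 : ℝ) ^ l i) ^ (1 - 2 / p) * ν i
      ≤ ∑ i, (1 / 2 : ℝ) ^ l i * (2 ^ (2 / p) * T ^ 2) := by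
        refine Finset.sum_le_sum fun i _ => ?_
        have hω : (0 : ℝ) < (1 / 2) ^ l i := by positivity
        set ω := (1 / 2 : ℝ) ^ l i
        have h1 : ν i ^ (p / 2) ≤ 2 * T ^ p * ω := by
          have h2 : ν i ^ (p / 2) / T ^ p ≤ 2 * ω := by
            have := hl2 i
            have := hcard i
            simp only [hw] at *
            linarith
          rw [div_le_iff₀ hTp] at h2
          linarith
        have h3 : ν i ≤ 2 ^ (2 / p) * T ^ 2 * ω ^ (2 / p) := by
          calc ν i = (ν i ^ (p / 2)) ^ (2 / p) := by
                rw [← Real.rpow_mul (hν i)]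
                have : p / 2 * (2 / p) = 1 := by field_simp
                rw [this, Real.rpow_one]
            _ ≤ (2 * T ^ p * ω) ^ (2 / p) :=
                Real.rpow_le_rpow (Real.rpow_nonneg (hν i) _) h1 (by positivity)
            _ = _ := by
                rw [Real.mul_rpow (by positivity) hω.le, Real.mul_rpow (by norm_num) hTp.le,
                  ← Real.rpow_mul hT.le, mul_div_cancel₀ _ hp.ne']
                norm_num
        calc ω ^ (1 - 2 / p) * ν i ≤ ω ^ (1 - 2 / p) * (2 ^ (2 / p) * T ^ 2 * ω ^ (2 / p)) := by
              gcongr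
          _ = (ω ^ (1 - 2 / p) * ω ^ (2 / p)) * (2 ^ (2 / p) * T ^ 2) := by ring
          _ = _ := by rw [← Real.rpow_add hω, sub_add_cancel, Real.rpow_one]
    _ = (∑ i, (1 / 2 : ℝ) ^ l i) * (2 ^ (2 / p) * T ^ 2) := by rw [Finset.sum_mul]
    _ ≤ _ := by gcongr

lemma half_pow_min_rpow_le {k l : ℕ} {p : ℝ} (hp : 0 < p) (hp2 : p < 2) :
    ((1 / 2 : ℝ) ^ min k l) ^ (1 - 2 / p) ≤ ((1 / 2 : ℝ) ^ l) ^ (1 - 2 / p) := by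
  refine Real.rpow_le_rpow_of_nonpos (by positivity)
    (pow_le_pow_of_le_one (by norm_num) (by norm_num) (min_le_right _ _)) ?_
  rw [sub_nonpos, one_le_div hp]
  exact hp2.le

/-- Dyadic weights in suitable orthonormal bases adapted to a decomposition of `x` in
`|||·|||_p`, for which the weighted Hilbert-Schmidt norm of `x` is controlled. -/
lemma exists_unitary_dyadic_weights {p T : ℝ} (hp : 0 < p) (hp2 : p < 2) (hT : 0 < T) {n N : ℕ}
    {x : Fin N → Matrix (Fin n) (Fin n) ℂ} (hx : tripleNorm p x < T) :
    ∃ (U V : Matrix (Fin n) (Fin n) ℂ) (k l : Fin n → ℕ), Uᴴ * U = 1 ∧ U * Uᴴ = 1 ∧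
      Vᴴ * V = 1 ∧ V * Vᴴ = 1 ∧ ∑ i, (1 / 2 : ℝ) ^ k i ≤ 2 ∧ ∑ i, (1 / 2 : ℝ) ^ l i ≤ 2 ∧
      ∑ i, ∑ b, ((1 / 2 : ℝ) ^ min (k i) (l b)) ^ (1 - 2 / p) *
        ∑ j, Complex.normSq ((Uᴴ * x j * V) i b) ≤ 8 * (2 ^ (2 / p) * T ^ 2) := by
  obtain ⟨a, b, hxab, ha, hb⟩ := exists_decomposition_of_tripleNorm_lt hp hx
  have hb' : specSum (fun t => t ^ (p / 2)) (∑ j, ((b j)ᴴ)ᴴ * (b j)ᴴ) ≤ T ^ p := by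
    simpa using hb
  obtain ⟨V, ν, hV1, hV2, hν, hVd, hVs⟩ := exists_unitary_diagonal (posSemidef_sum_gram a)
  obtain ⟨U, ν', hU1, hU2, hν', hUd, hUs⟩ :=
    exists_unitary_diagonal (posSemidef_sum_gram fun j => (b j)ᴴ)
  rw [hVs] at ha
  rw [hUs] at hb'
  obtain ⟨l, hl1, hl2⟩ := exists_dyadic_weights hp hT ν hν ha
  obtain ⟨k, hk1, hk2⟩ := exists_dyadic_weights hp hT ν' hν' hb'
  refine ⟨U, V, k, l, hU1, hU2, hV1, hV2, hk1, hl1, ?_⟩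
  have hcol : ∀ i, ∑ c, ∑ j, Complex.normSq ((Uᴴ * a j * V) c i) = ν i := by
    intro i
    rw [Finset.sum_comm, ← gram_diag_re]
    have : ∑ j, (Uᴴ * a j * V)ᴴ * (Uᴴ * a j * V) = Vᴴ * (∑ j, (a j)ᴴ * a j) * V := by
      rw [Finset.mul_sum, Finset.sum_mul]
      refine Finset.sum_congr rfl fun j _ => ?_
      calc _ = Vᴴ * (a j)ᴴ * (U * Uᴴ) * a j * V := by
            simp only [Matrix.conjTranspose_mul, Matrix.conjTranspose_conjTranspose,
              Matrix.mul_assoc]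
        _ = _ := by rw [hU2, Matrix.mul_one, Matrix.mul_assoc Vᴴ]
    rw [this, hVd, Matrix.diagonal_apply_eq, Complex.ofReal_re]
  have hrow : ∀ i, ∑ c, ∑ j, Complex.normSq ((Uᴴ * b j * V) i c) = ν' i := by
    intro i
    have h1 := gram_diag_re (fun j => (Uᴴ * b j * V)ᴴ) i
    have : ∑ j, ((Uᴴ * b j * V)ᴴ)ᴴ * (Uᴴ * b j * V)ᴴ = Uᴴ * (∑ j, ((b j)ᴴ)ᴴ * (b j)ᴴ) * U := by
      rw [Finset.mul_sum, Finset.sum_mul]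
      refine Finset.sum_congr rfl fun j _ => ?_
      calc _ = Uᴴ * b j * (V * Vᴴ) * (b j)ᴴ * U := by
            simp only [Matrix.conjTranspose_mul, Matrix.conjTranspose_conjTranspose,
              Matrix.mul_assoc]
        _ = _ := by
          rw [hV2, Matrix.mul_one, Matrix.conjTranspose_conjTranspose, Matrix.mul_assoc Uᴴ]
    rw [this, hUd, Matrix.diagonal_apply_eq, Complex.ofReal_re] at h1
    rw [h1, Finset.sum_comm]
    simp [Matrix.conjTranspose_apply, -Matrix.conjTranspose_mul, Complex.normSq_conj]
  calc ∑ i, ∑ c, ((1 / 2 : ℝ) ^ min (k i) (l c)) ^ (1 - 2 / p) *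
        ∑ j, Complex.normSq ((Uᴴ * x j * V) i c)
      ≤ ∑ i, ∑ c, (2 * (((1 / 2 : ℝ) ^ l c) ^ (1 - 2 / p) *
          ∑ j, Complex.normSq ((Uᴴ * a j * V) i c)) +
        2 * (((1 / 2 : ℝ) ^ k i) ^ (1 - 2 / p) *
          ∑ j, Complex.normSq ((Uᴴ * b j * V) i c))) := by
        refine Finset.sum_le_sum fun i _ => Finset.sum_le_sum fun c _ => ?_
        have h1 : ∑ j, Complex.normSq ((Uᴴ * x j * V) i c) ≤
            2 * ∑ j, Complex.normSq ((Uᴴ * a j * V) i c) +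
              2 * ∑ j, Complex.normSq ((Uᴴ * b j * V) i c) := by
          rw [Finset.mul_sum, Finset.mul_sum, ← Finset.sum_add_distrib]
          refine Finset.sum_le_sum fun j _ => ?_
          rw [hxab, Matrix.mul_add, Matrix.add_mul, Matrix.add_apply, Complex.normSq_apply,
            Complex.normSq_apply, Complex.normSq_apply, Complex.add_re, Complex.add_im]
          nlinarith [sq_nonneg (((Uᴴ * a j * V) i c).re - ((Uᴴ * b j * V) i c).re),
            sq_nonneg (((Uᴴ * a j * V) i c).im - ((Uᴴ * b j * V) i c).im)]
        have h2 := half_pow_min_rpow_le (k := k i) (l := l c) hp hp2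
        have h3 := half_pow_min_rpow_le (k := l c) (l := k i) hp hp2
        rw [min_comm] at h3
        have ha0 : 0 ≤ ∑ j, Complex.normSq ((Uᴴ * a j * V) i c) :=
          Finset.sum_nonneg fun j _ => Complex.normSq_nonneg _
        have hb0 : 0 ≤ ∑ j, Complex.normSq ((Uᴴ * b j * V) i c) :=
          Finset.sum_nonneg fun j _ => Complex.normSq_nonneg _
        have h4 := mul_le_mul_of_nonneg_right h2 ha0
        have h5 := mul_le_mul_of_nonneg_right h3 hb0
        have h6 := mul_le_mul_of_nonneg_left h1
          (show 0 ≤ ((1 / 2 : ℝ) ^ min (k i) (l c)) ^ (1 - 2 / p) by positivity)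
        linarith
    _ = 2 * ∑ c, ((1 / 2 : ℝ) ^ l c) ^ (1 - 2 / p) * ν c +
        2 * ∑ i, ((1 / 2 : ℝ) ^ k i) ^ (1 - 2 / p) * ν' i := by
        simp only [Finset.sum_add_distrib, ← Finset.mul_sum, hrow]
        rw [Finset.sum_comm]
        simp only [← Finset.mul_sum, hcol]
    _ ≤ _ := by linarith

/-- The averaged form of the Schur multiplier estimate. -/
lemma radAvg_schur_multiplier_le {p q : ℝ} (hp : 0 < p) (hpq : p < q) (hq : q < 2) :
    ∃ C : ℝ, 0 < C ∧ ∀ (n N : ℕ) (y z : Fin N → Matrix (Fin n) (Fin n) ℂ) (k l : Fin n → ℕ)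
      (c : ℝ), 0 < c →
      (∀ j a b, z j a b = y j a b * (((((1 / 2 : ℝ) ^ k a) ^ (1 / p - 1 / q) +
        ((1 / 2 : ℝ) ^ l b) ^ (1 / p - 1 / q))⁻¹ : ℝ) : ℂ)) →
      radAvg q z ≤ C * (c ^ (q - p) * radAvg p y + c ^ (q - 2) * ∑ a, ∑ b,
        ((1 / 2 : ℝ) ^ min (k a) (l b)) ^ (1 - 2 / p) * ∑ j, Complex.normSq (y j a b)) := by
  obtain ⟨C, hC, h⟩ := specSum_schur_multiplier_le hp hpq hq
  refine ⟨C, hC, fun n N y z k l c hc hz => ?_⟩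
  rw [radAvg_eq (hp.trans hpq), radAvg_eq hp]
  have key := Finset.sum_le_sum fun (ε : Fin N → Bool) (_ : ε ∈ Finset.univ) =>
    h (∑ j, (if ε j then (1 : ℂ) else -1) • y j) (∑ j, (if ε j then (1 : ℂ) else -1) • z j)
      k l c hc fun a b => by
        simp only [Matrix.sum_apply, Matrix.smul_apply, smul_eq_mul, Finset.sum_mul, hz, mul_assoc]
  rw [← Finset.mul_sum, Finset.sum_add_distrib, ← Finset.mul_sum, ← Finset.mul_sum] at key
  have horth : ∑ ε : Fin N → Bool, ∑ a, ∑ b, ((1 / 2 : ℝ) ^ min (k a) (l b)) ^ (1 - 2 / p) *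
        Complex.normSq ((∑ j, (if ε j then (1 : ℂ) else -1) • y j) a b) =
      2 ^ N * ∑ a, ∑ b, ((1 / 2 : ℝ) ^ min (k a) (l b)) ^ (1 - 2 / p) *
        ∑ j, Complex.normSq (y j a b) := by
    rw [Finset.sum_comm, Finset.mul_sum]
    refine Finset.sum_congr rfl fun a _ => ?_
    rw [Finset.sum_comm, Finset.mul_sum]
    refine Finset.sum_congr rfl fun b _ => ?_
    rw [← Finset.mul_sum]
    simp only [Matrix.sum_apply, Matrix.smul_apply, smul_eq_mul]
    rw [sum_signs_normSq N fun j => y j a b]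
    ring
  rw [horth] at key
  refine (mul_le_mul_of_nonneg_left key (by positivity)).trans (le_of_eq ?_)
  field_simp

lemma exists_forall_le_mul_rpow {p q C : ℝ} (hp : 0 < p) (hq : q < 2) (hC : 0 < C) :
    ∃ C' : ℝ, 0 < C' ∧ ∀ t R : ℝ, 0 < t → 0 ≤ R →
      (∀ c, 0 < c → t ^ q ≤ C * (c ^ (q - p) * R + c ^ (q - 2) * t ^ 2)) →
      t ≤ C' * R ^ (1 / p) := by
  set K := (2 * C) ^ (1 / (2 - q)) with hK
  have hK0 : 0 < K := by positivity
  refine ⟨(2 * C * K ^ (q - p)) ^ (1 / p), by positivity, fun t R ht hR h => ?_⟩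
  have h1 := h (K * t) (by positivity)
  have e1 : K ^ (q - 2) = (2 * C)⁻¹ := by
    rw [hK, ← Real.rpow_mul (by positivity), ← Real.rpow_neg_one]
    congr 1
    have : 2 - q ≠ 0 := by linarith
    field_simp
    ring
  have e2 : t ^ (q - 2) * t ^ 2 = t ^ q := by
    rw [← Real.rpow_natCast, ← Real.rpow_add ht]
    congr 1
    push_cast
    ring
  have e3 : t ^ (q - p) * t ^ p = t ^ q := by
    rw [← Real.rpow_add ht, sub_add_cancel]
  rw [Real.mul_rpow hK0.le ht.le, Real.mul_rpow hK0.le ht.le, e1, mul_assoc _ (t ^ (q - 2)), e2,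
    mul_add, ← mul_assoc C, ← mul_assoc C] at h1
  have e4 : C * (2 * C)⁻¹ = 1 / 2 := by field_simp
  rw [← mul_assoc C, e4, ← e3] at h1
  have h2 : t ^ p ≤ 2 * C * K ^ (q - p) * R := by
    have h3 : 0 < t ^ (q - p) := by positivity
    refine le_of_mul_le_mul_left ?_ h3
    linarith
  calc t = (t ^ p) ^ (1 / p) := by
        rw [← Real.rpow_mul ht.le, mul_one_div_cancel hp.ne', Real.rpow_one]
    _ ≤ (2 * C * K ^ (q - p) * R) ^ (1 / p) := Real.rpow_le_rpow (by positivity) h2 (by positivity)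
    _ = _ := Real.mul_rpow (by positivity) hR

lemma khintchine_extrapolation_step {p q β : ℝ} (hp : 0 < p) (hpq : p < q) (hq : q < 2)
    (hδ : 1 / p - 1 / q ≤ 1 / 2)
    (hK : ∀ (n N : ℕ) (x : Fin N → Matrix (Fin n) (Fin n) ℂ),
      tripleNorm q x ≤ β * (radAvg q x) ^ (1 / q)) :
    ∃ β' : ℝ, 0 < β' ∧ ∀ (n N : ℕ) (x : Fin N → Matrix (Fin n) (Fin n) ℂ),
      tripleNorm p x ≤ β' * (radAvg p x) ^ (1 / p) := by
  have hq0 : 0 < q := hp.trans hpq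
  obtain ⟨C, hC, hmult⟩ := radAvg_schur_multiplier_le hp hpq hq
  obtain ⟨B, hβB, hB1⟩ : ∃ B, β ≤ B ∧ 1 ≤ B := ⟨max β 1, le_max_left _ _, le_max_right _ _⟩
  obtain ⟨C₁, hC₁⟩ : ∃ C₁, C₁ = 2 * (3 * (16 ^ (1 / p) * (2 * B))) := ⟨_, rfl⟩
  have hC₁0 : 0 < C₁ := by rw [hC₁]; positivity
  obtain ⟨C₂, hC₂⟩ : ∃ C₂ : ℝ, C₂ = 32 * 2 ^ (2 / p) := ⟨_, rfl⟩
  have hC₂1 : 1 ≤ C₂ := by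
    have : (1 : ℝ) ≤ 2 ^ (2 / p) := Real.one_le_rpow (by norm_num) (by positivity)
    linarith
  obtain ⟨C', hC', hfin⟩ := exists_forall_le_mul_rpow (C := C₁ ^ q * (C * C₂)) hp hq
    (by positivity)
  refine ⟨C', hC', fun n N x => ?_⟩
  have hR := radAvg_nonneg hp x
  rcases le_or_gt (tripleNorm p x) 0 with ht | ht
  · exact ht.trans (by positivity)
  refine hfin _ _ ht hR fun c hc => ?_
  set t := tripleNorm p x with ht_def
  obtain ⟨U, V, k, l, hU1, hU2, hV1, hV2, hk, hl, hE⟩ :=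
    exists_unitary_dyadic_weights (T := 2 * t) hp (hpq.trans hq) (by positivity)
      (x := x) (by linarith)
  obtain ⟨y, hy⟩ : ∃ y : Fin N → Matrix (Fin n) (Fin n) ℂ, y = fun j => Uᴴ * x j * V := ⟨_, rfl⟩
  have hyj : ∀ j, Uᴴ * x j * V = y j := fun j => by rw [hy]
  obtain ⟨z, hz⟩ : ∃ z : Fin N → Matrix (Fin n) (Fin n) ℂ, ∀ j a b, z j a b =
      y j a b * (((((1 / 2 : ℝ) ^ k a) ^ (1 / p - 1 / q) +
        ((1 / 2 : ℝ) ^ l b) ^ (1 / p - 1 / q))⁻¹ : ℝ) : ℂ) :=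
    ⟨fun j => Matrix.of fun a b => _, fun j a b => rfl⟩
  have hrad : radAvg p y = radAvg p x := by rw [hy]; exact radAvg_unitary hp x hU2 hV2
  simp only [hyj] at hE
  have hzle := hmult n N y z k l c hc hz
  rw [hrad] at hzle
  obtain ⟨D, hD⟩ : ∃ D, D = C * C₂ * (c ^ (q - p) * radAvg p x + c ^ (q - 2) * t ^ 2) := ⟨_, rfl⟩
  have hD0 : 0 < D := by rw [hD]; positivity
  have hzD : radAvg q z ≤ D := by
    refine hzle.trans ?_
    rw [hD, mul_assoc C]
    refine mul_le_mul_of_nonneg_left ?_ hC.le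
    have h1 := mul_le_mul_of_nonneg_left hE (show 0 ≤ c ^ (q - 2) by positivity)
    have h2 : 0 ≤ (C₂ - 1) * (c ^ (q - p) * radAvg p x) :=
      mul_nonneg (by linarith) (by positivity)
    have h3 : c ^ (q - 2) * (8 * (2 ^ (2 / p) * (2 * t) ^ 2)) = C₂ * (c ^ (q - 2) * t ^ 2) := by
      rw [hC₂]; ring
    linarith
  have hztriple : tripleNorm q z < 2 * B * D ^ (1 / q) := by
    have h0 := radAvg_nonneg hq0 z
    calc tripleNorm q z ≤ β * radAvg q z ^ (1 / q) := hK n N z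
      _ ≤ B * D ^ (1 / q) :=
        mul_le_mul hβB (Real.rpow_le_rpow h0 hzD (by positivity))
          (Real.rpow_nonneg h0 _) (by positivity)
      _ < _ := by
        have : 0 < B * D ^ (1 / q) := by positivity
        linarith
  have hytriple := tripleNorm_lifting_le hp hpq hq hδ y z (fun a => (1 / 2 : ℝ) ^ k a)
    (fun b => (1 / 2 : ℝ) ^ l b) (fun _ => by positivity) (fun _ => by positivity) hk hl
    (fun j => by
      ext a b
      rw [Matrix.add_apply, Matrix.diagonal_mul, Matrix.mul_diagonal]
      rw [hz]
      have hne : (((1 / 2 : ℝ) ^ k a) ^ (1 / p - 1 / q) +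
        ((1 / 2 : ℝ) ^ l b) ^ (1 / p - 1 / q)) ≠ 0 := by positivity
      rw [mul_comm (y j a b * _) _, ← add_mul, ← Complex.ofReal_add, mul_comm (y j a b),
        ← mul_assoc, ← Complex.ofReal_mul, mul_inv_cancel₀ hne, Complex.ofReal_one, one_mul])
    (by positivity) hztriple
  have hxy : ∀ j, x j = U * y j * Vᴴ := fun j => by
    calc x j = (U * Uᴴ) * x j * (V * Vᴴ) := by rw [hU2, hV2, Matrix.one_mul, Matrix.mul_one]
      _ = _ := by simp only [← hyj, Matrix.mul_assoc]
  have hpos : 0 < 16 ^ (1 / p) * (2 * B * D ^ (1 / q)) := by positivity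
  have htle := tripleNorm_le_of_unitary hp hU1 hV1 hxy
    (u := 3 * (16 ^ (1 / p) * (2 * B * D ^ (1 / q))))
    (by positivity) (by linarith)
  have htle' : t ≤ C₁ * D ^ (1 / q) := by
    refine htle.trans (le_of_eq ?_)
    rw [hC₁]; ring
  calc t ^ q ≤ (C₁ * D ^ (1 / q)) ^ q := Real.rpow_le_rpow ht.le htle' hq0.le
    _ = C₁ ^ q * D := by
      rw [Real.mul_rpow hC₁0.le (by positivity), ← Real.rpow_mul hD0.le,
        one_div_mul_cancel hq0.ne', Real.rpow_one]
    _ = _ := by rw [hD]; ring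

lemma khintchine_extrapolation (m : ℕ) {p q β : ℝ} (hp : 0 < p) (hpq : p < q) (hq : q < 2)
    (hδ : 1 / p - 1 / q ≤ m / 2)
    (hK : ∀ (n N : ℕ) (x : Fin N → Matrix (Fin n) (Fin n) ℂ),
      tripleNorm q x ≤ β * (radAvg q x) ^ (1 / q)) :
    ∃ β' : ℝ, 0 < β' ∧ ∀ (n N : ℕ) (x : Fin N → Matrix (Fin n) (Fin n) ℂ),
      tripleNorm p x ≤ β' * (radAvg p x) ^ (1 / p) := by
  induction m generalizing p with
  | zero =>
    have := one_div_lt_one_div_of_lt hp hpq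
    norm_num at hδ
    norm_num at this
    linarith
  | succ m ih =>
    rcases le_or_gt (1 / p - 1 / q) (1 / 2) with h | h
    · exact khintchine_extrapolation_step hp hpq hq h hK
    · have hq0 : 0 < 1 / q := one_div_pos.2 (hp.trans hpq)
      have hr : 0 < 1 / p - 1 / 2 := by linarith
      have hrp : 1 / (1 / (1 / p - 1 / 2)) = 1 / p - 1 / 2 := one_div_one_div _
      have hpr : p < 1 / (1 / p - 1 / 2) := by
        rw [lt_div_iff₀ hr, mul_sub, mul_one_div_cancel hp.ne']
        linarith
      have hrq : 1 / (1 / p - 1 / 2) < q := by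
        rw [div_lt_comm₀ hr (hp.trans hpq)]
        linarith
      obtain ⟨β₁, -, h₁⟩ := ih (p := 1 / (1 / p - 1 / 2)) (by positivity) hrq
        (by rw [hrp]; push_cast at hδ; linarith)
      exact khintchine_extrapolation_step hp hpr (hrq.trans hq) (by rw [hrp]; linarith) h₁

/-- Extrapolation of the non-commutative Khintchine inequality below exponent 1. -/
theorem statement3 (q p β : ℝ) (hq1 : 1 < q) (hq2 : q < 2) (hp0 : 0 < p) (hp1 : p < 1)
    (hK : ∀ (n N : ℕ) (x : Fin N → Matrix (Fin n) (Fin n) ℂ),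
      tripleNorm q x ≤ β * (radAvg q x) ^ (1 / q)) :
    ∃ β' : ℝ, 0 < β' ∧ ∀ (n N : ℕ) (x : Fin N → Matrix (Fin n) (Fin n) ℂ),
      tripleNorm p x ≤ β' * (radAvg p x) ^ (1 / p) := by
  obtain ⟨m, hm⟩ := exists_nat_ge (2 * (1 / p - 1 / q))
  exact khintchine_extrapolation m hp0 (hp1.trans hq1) hq2 (by linarith) hK
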